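/- Let V : ℝ → ℝ be six times continuously differentiable in a neighbourhood of 0 with V'(0) = 0 and V''(0) = 1, let m, d, a, k > 0, and set Ω² = a²d/k, ω_min = √(a²d/m), h = V⁗(0) − (5/3)(V'''(0))². Assume h < 0 and Ω² > 4/3. Then there exist δ > 0 and C ≥ 1 such that for every ω ∈ (ω_min − δ, ω_min) there exist two not-identically-zero families x¹ = (x¹_n)_{n∈ℤ} and x² = (x²_n)_{n∈ℤ} of twice continuously differentiable functions x^i_n : ℝ → ℝ satisfying, for all n ∈ ℤ and t ∈ ℝ, m·(x^i_n)''(t) + d·a·V'(a·x^i_n(t)) = k·(x^i_{n+1}(t) − 2x^i_n(t) + x^i_{n−1}(t)), with each x^i_n periodic of period 2π/ω and even in t, with the symmetries x¹_{−n+1} = x¹_n and x²_{−n} = x²_n for all n, and such that there exists σ > 1 with sup_t |x^i_n(t)| ≤ C (ω_min − ω)^{1/2} σ^{−|n|} for all n and C^{−1}(ω_min − ω)^{1/2} ≤ σ − 1 ≤ C(ω_min − ω)^{1/2}. -/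

import Mathlib

namespace KleinGordon

/-- Banach's fixed point theorem for the unit ball of the bounded functions on `ι`. -/
theorem exists_fixedPoint_unitBall {ι : Type*} (F : (ι → ℝ) → ι → ℝ) {q : ℝ}
    (hq0 : 0 ≤ q) (hq1 : q < 1)
    (hmap : ∀ x, (∀ i, |x i| ≤ 1) → ∀ i, |F x i| ≤ 1)
    (hlip : ∀ x y d, (∀ i, |x i| ≤ 1) → (∀ i, |y i| ≤ 1) → (∀ i, |x i - y i| ≤ d) →
      ∀ i, |F x i - F y i| ≤ q * d) :
    ∃ x, (∀ i, |x i| ≤ 1) ∧ F x = x := by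
  set a : ℕ → ι → ℝ := fun n => F^[n] 0 with ha
  have hsucc : ∀ n, a (n + 1) = F (a n) := fun n => Function.iterate_succ_apply' F n 0
  have hball : ∀ n i, |a n i| ≤ 1 := by
    intro n
    induction n with
    | zero => intro i; simp [ha]
    | succ n ih => rw [hsucc]; exact hmap _ ih
  have hstep : ∀ n i, |a n i - a (n + 1) i| ≤ 1 * q ^ n := by
    intro n
    induction n with
    | zero =>
      intro i
      have h := hball 1 i
      simpa [ha] using h
    | succ n ih =>
      intro i
      rw [hsucc n, hsucc (n + 1), hsucc n]
      have h := hlip _ _ _ (hball n) (hball (n + 1)) ih i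
      rw [hsucc n] at h
      calc _ ≤ _ := h
        _ = _ := by ring
  have hdist : ∀ i n, dist (a n i) (a (n + 1) i) ≤ 1 * q ^ n := fun i n => by
    rw [Real.dist_eq]; exact hstep n i
  have hlim : ∀ i, ∃ b, Filter.Tendsto (fun n => a n i) Filter.atTop (nhds b) := fun i =>
    cauchySeq_tendsto_of_complete (cauchySeq_of_le_geometric q 1 hq1 (hdist i))
  choose b hb using hlim
  have hb1 : ∀ i, |b i| ≤ 1 := fun i =>
    le_of_tendsto (hb i).abs (Filter.Eventually.of_forall fun n => hball n i)
  have hclose : ∀ n i, |a n i - b i| ≤ 1 * q ^ n / (1 - q) := fun n i => by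
    rw [← Real.dist_eq]
    exact dist_le_of_le_geometric_of_tendsto q 1 hq1 (hdist i) (hb i) n
  refine ⟨b, hb1, funext fun i => ?_⟩
  have h1 : Filter.Tendsto (fun n => a (n + 1) i) Filter.atTop (nhds (b i)) :=
    (hb i).comp (Filter.tendsto_add_atTop_nat 1)
  have h2 : Filter.Tendsto (fun n => a (n + 1) i) Filter.atTop (nhds (F b i)) := by
    rw [tendsto_iff_dist_tendsto_zero]
    have h3 : Filter.Tendsto (fun n => q * (1 * q ^ n / (1 - q))) Filter.atTop (nhds 0) := by
      have := (((tendsto_pow_atTop_nhds_zero_of_lt_one hq0 hq1).const_mul 1).div_const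
        (1 - q)).const_mul q
      simpa using this
    refine squeeze_zero (fun _ => dist_nonneg) (fun n => ?_) h3
    rw [Real.dist_eq, hsucc]
    exact hlip _ _ _ (hball n) hb1 (hclose n) i
  exact tendsto_nhds_unique h2 h1

end KleinGordon

namespace KleinGordon

open intervalIntegral

/-- The `j`-th coefficient of the cosine expansion of `g` on `[0, π]`. -/
noncomputable def cosCoeff (g : ℝ → ℝ) (j : ℕ) : ℝ :=
  (if j = 0 then 1 else 2) / Real.pi * ∫ t in (0 : ℝ)..Real.pi, g t * Real.cos (j * t)

/-- The sum of a cosine series. -/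
noncomputable def cosSeries (c : ℕ → ℝ) (t : ℝ) : ℝ := ∑' j : ℕ, c j * Real.cos (j * t)

theorem cosCoeff_add {f g : ℝ → ℝ} (hf : Continuous f) (hg : Continuous g) (j : ℕ) :
    cosCoeff (fun t => f t + g t) j = cosCoeff f j + cosCoeff g j := by
  unfold cosCoeff
  rw [← mul_add, ← integral_add (Continuous.intervalIntegrable (by fun_prop) _ _)
    (Continuous.intervalIntegrable (by fun_prop) _ _)]
  simp_rw [add_mul]

theorem cosCoeff_const_mul (a : ℝ) (f : ℝ → ℝ) (j : ℕ) :
    cosCoeff (fun t => a * f t) j = a * cosCoeff f j := by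
  unfold cosCoeff
  simp_rw [mul_assoc, integral_const_mul]
  ring

theorem cosCoeff_sub {f g : ℝ → ℝ} (hf : Continuous f) (hg : Continuous g) (j : ℕ) :
    cosCoeff (fun t => f t - g t) j = cosCoeff f j - cosCoeff g j := by
  unfold cosCoeff
  rw [← mul_sub, ← integral_sub (Continuous.intervalIntegrable (by fun_prop) _ _)
    (Continuous.intervalIntegrable (by fun_prop) _ _)]
  simp_rw [sub_mul]

theorem abs_cosCoeff_le {f : ℝ → ℝ} {M : ℝ} (hf : ∀ t, |f t| ≤ M) (j : ℕ) :
    |cosCoeff f j| ≤ 2 * M := by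
  have hM : 0 ≤ M := (abs_nonneg _).trans (hf 0)
  have h : ‖∫ t in (0 : ℝ)..Real.pi, f t * Real.cos (j * t)‖ ≤ M * |Real.pi - 0| := by
    refine norm_integral_le_of_norm_le_const fun t _ => ?_
    rw [Real.norm_eq_abs, abs_mul]
    exact (mul_le_of_le_one_right (abs_nonneg _) (Real.abs_cos_le_one _)).trans (hf t)
  rw [sub_zero, abs_of_pos Real.pi_pos, Real.norm_eq_abs] at h
  unfold cosCoeff
  rw [abs_mul, abs_div, abs_of_pos Real.pi_pos]
  have h2 : |(if j = 0 then 1 else 2 : ℝ)| ≤ 2 := by split_ifs <;> norm_num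
  calc _ ≤ 2 / Real.pi * (M * Real.pi) := by gcongr
    _ = 2 * M := by field_simp

theorem integral_cos_nat_mul {n : ℤ} (hn : n ≠ 0) :
    ∫ t in (0 : ℝ)..Real.pi, Real.cos (n * t) = 0 := by
  have hn' : (n : ℝ) ≠ 0 := Int.cast_ne_zero.mpr hn
  rw [integral_comp_mul_left (fun t => Real.cos t) hn', integral_cos]
  simp [Real.sin_int_mul_pi]

/-- Orthogonality of the cosines. -/
theorem cosCoeff_cos (i j : ℕ) :
    cosCoeff (fun t => Real.cos (i * t)) j = if i = j then 1 else 0 := by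
  have hprod : ∀ t : ℝ, Real.cos (i * t) * Real.cos (j * t) =
      (Real.cos (((i - j : ℤ) : ℝ) * t) + Real.cos (((i + j : ℤ) : ℝ) * t)) / 2 := by
    intro t
    push_cast
    rw [sub_mul, add_mul, Real.cos_sub, Real.cos_add]
    ring
  unfold cosCoeff
  simp_rw [hprod]
  rw [integral_div, integral_add (Continuous.intervalIntegrable (by fun_prop) _ _)
    (Continuous.intervalIntegrable (by fun_prop) _ _)]
  have hpi := Real.pi_ne_zero
  by_cases hij : i = j
  · subst hij
    by_cases hi : i = 0
    · subst hi
      simp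
    · rw [integral_cos_nat_mul (n := (i + i : ℤ)) (by omega)]
      simp [hi]
  · rw [integral_cos_nat_mul (n := (i + j : ℤ)) (by omega),
      integral_cos_nat_mul (n := (i - j : ℤ)) (by omega)]
    simp [hij]

theorem summable_inv_one_add_sq : Summable fun j : ℕ => 1 / (1 + (j : ℝ) ^ 2) := by
  refine Summable.of_nonneg_of_le (fun j => by positivity) (fun j => ?_)
    ((summable_nat_add_iff 1).mpr (Real.summable_one_div_nat_pow.mpr one_lt_two) |>.mul_left 2)
  rw [mul_one_div, div_le_div_iff₀ (by positivity) (by positivity)]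
  push_cast
  nlinarith [sq_nonneg ((j : ℝ) - 1)]

section Series
variable {c : ℕ → ℝ} {M : ℝ} (hc : ∀ j, |c j| ≤ M / (1 + (j : ℝ) ^ 2))
include hc

theorem summable_abs_of_le : Summable fun j => |c j| :=
  Summable.of_nonneg_of_le (fun _ => abs_nonneg _) (fun j => by simpa [div_eq_mul_inv] using hc j)
    (summable_inv_one_add_sq.mul_left M)

theorem summable_cosSeries (t : ℝ) : Summable fun j : ℕ => c j * Real.cos (j * t) := by
  refine Summable.of_norm_bounded (summable_abs_of_le hc) fun j => ?_
  rw [Real.norm_eq_abs, abs_mul]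
  exact mul_le_of_le_one_right (abs_nonneg _) (Real.abs_cos_le_one _)

theorem abs_cosSeries_le (t : ℝ) :
    |cosSeries c t| ≤ M * ∑' j : ℕ, 1 / (1 + (j : ℝ) ^ 2) := by
  rw [← tsum_mul_left, ← Real.norm_eq_abs]
  refine tsum_of_norm_bounded (summable_inv_one_add_sq.mul_left M).hasSum fun j => ?_
  rw [Real.norm_eq_abs, abs_mul, mul_one_div]
  exact (mul_le_of_le_one_right (abs_nonneg _) (Real.abs_cos_le_one _)).trans (hc j)

theorem continuous_cosSeries : Continuous (cosSeries c) := by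
  refine continuous_tsum (fun j => by fun_prop) (summable_abs_of_le hc) fun j t => ?_
  rw [Real.norm_eq_abs, abs_mul]
  exact mul_le_of_le_one_right (abs_nonneg _) (Real.abs_cos_le_one _)

theorem cosCoeff_cosSeries (j : ℕ) : cosCoeff (cosSeries c) j = c j := by
  have h := intervalIntegral.hasSum_integral_of_dominated_convergence (a := 0) (b := Real.pi)
    (μ := MeasureTheory.volume)
    (F := fun (i : ℕ) t => c i * Real.cos (i * t) * Real.cos (j * t))
    (f := fun t => cosSeries c t * Real.cos (j * t)) (fun i _ => |c i|)
    (fun i => Continuous.aestronglyMeasurable (by fun_prop))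
    (fun i => Filter.Eventually.of_forall fun t _ => by
      rw [Real.norm_eq_abs, abs_mul, abs_mul]
      exact (mul_le_of_le_one_right (by positivity) (Real.abs_cos_le_one _)).trans
        (mul_le_of_le_one_right (abs_nonneg _) (Real.abs_cos_le_one _)))
    (Filter.Eventually.of_forall fun t _ => summable_abs_of_le hc)
    (by simp)
    (Filter.Eventually.of_forall fun t _ =>
      (summable_cosSeries hc t).hasSum.mul_right _)
  have h2 := h.mul_left ((if j = 0 then 1 else 2) / Real.pi)
  have h3 : ∀ i : ℕ, (if j = 0 then 1 else 2) / Real.pi *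
      ∫ t in (0 : ℝ)..Real.pi, c i * Real.cos (i * t) * Real.cos (j * t) =
      c i * if i = j then 1 else 0 := by
    intro i
    rw [← cosCoeff_cos, ← cosCoeff_const_mul]
    rfl
  simp_rw [h3] at h2
  refine h2.unique ?_
  have := hasSum_ite_eq j (c j)
  refine this.congr_fun ?_
  intro i
  by_cases hij : i = j <;> simp [hij]

end Series

theorem cosSeries_neg (c : ℕ → ℝ) (t : ℝ) : cosSeries c (-t) = cosSeries c t := by
  simp [cosSeries]

theorem periodic_cosSeries (c : ℕ → ℝ) : Function.Periodic (cosSeries c) (2 * Real.pi) := by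
  intro t
  unfold cosSeries
  congr 1
  ext j
  rw [mul_add, Real.cos_add_nat_mul_two_pi]

theorem cosSeries_add {c c' : ℕ → ℝ} {M M' : ℝ} (hc : ∀ j, |c j| ≤ M / (1 + (j : ℝ) ^ 2))
    (hc' : ∀ j, |c' j| ≤ M' / (1 + (j : ℝ) ^ 2)) (t : ℝ) :
    cosSeries (fun j => c j + c' j) t = cosSeries c t + cosSeries c' t := by
  unfold cosSeries
  rw [← (summable_cosSeries hc t).tsum_add (summable_cosSeries hc' t)]
  simp_rw [add_mul]

theorem cosSeries_sub {c c' : ℕ → ℝ} {M M' : ℝ} (hc : ∀ j, |c j| ≤ M / (1 + (j : ℝ) ^ 2))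
    (hc' : ∀ j, |c' j| ≤ M' / (1 + (j : ℝ) ^ 2)) (t : ℝ) :
    cosSeries (fun j => c j - c' j) t = cosSeries c t - cosSeries c' t := by
  unfold cosSeries
  rw [← (summable_cosSeries hc t).tsum_sub (summable_cosSeries hc' t)]
  simp_rw [sub_mul]

/-- A continuous even `2π`-periodic function orthogonal to all cosines vanishes. -/
theorem eq_zero_of_cosCoeff_eq_zero {g : ℝ → ℝ} (hg : Continuous g) (heven : ∀ t, g (-t) = g t)
    (hper : Function.Periodic g (2 * Real.pi)) (h0 : ∀ j, cosCoeff g j = 0) (t : ℝ) :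
    g t = 0 := by
  have hint : ∀ j : ℕ, ∫ t in (0 : ℝ)..Real.pi, g t * Real.cos (j * t) = 0 := by
    intro j
    have h := h0 j
    unfold cosCoeff at h
    refine (mul_eq_zero.mp h).resolve_left ?_
    have := Real.pi_ne_zero
    split_ifs <;> positivity
  have hpow : ∀ k j : ℕ, ∫ t in (0 : ℝ)..Real.pi, g t * (Real.cos t ^ k * Real.cos (j * t)) = 0 := by
    intro k
    induction k with
    | zero => simpa using hint
    | succ k ih =>
      intro j
      have hs : ∀ t : ℝ, g t * (Real.cos t ^ (k + 1) * Real.cos (j * t)) =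
          (g t * (Real.cos t ^ k * Real.cos ((j + 1 : ℕ) * t)) +
            g t * (Real.cos t ^ k * Real.cos (((j : ℤ) - 1).natAbs * t))) / 2 := by
        intro t
        have h1 : Real.cos ((((j : ℤ) - 1).natAbs : ℝ) * t) = Real.cos ((j - 1) * t) := by
          have h2 : ((((j : ℤ) - 1).natAbs : ℕ) : ℝ) = |(j : ℝ) - 1| := by
            rw [Nat.cast_natAbs]
            push_cast
            rfl
          rw [h2]
          rcases abs_cases ((j : ℝ) - 1) with h | h <;> rw [h.1]
          rw [neg_mul, Real.cos_neg]
        rw [h1]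
        push_cast
        rw [sub_mul, add_mul, Real.cos_sub, Real.cos_add, one_mul]
        ring
      simp_rw [hs]
      rw [integral_div, integral_add (Continuous.intervalIntegrable (by fun_prop) _ _)
        (Continuous.intervalIntegrable (by fun_prop) _ _), ih, ih]
      simp
  have hpoly : ∀ p : Polynomial ℝ, ∫ t in (0 : ℝ)..Real.pi, g t * p.eval (Real.cos t) = 0 := by
    intro p
    induction p using Polynomial.induction_on' with
    | add p q hp hq =>
      simp_rw [Polynomial.eval_add, mul_add]
      rw [integral_add (Continuous.intervalIntegrable (by fun_prop) _ _)
        (Continuous.intervalIntegrable (by fun_prop) _ _), hp, hq, add_zero]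
    | monomial n a =>
      have h := hpow n 0
      simp only [Nat.cast_zero, zero_mul, Real.cos_zero, mul_one] at h
      simp_rw [Polynomial.eval_monomial, mul_left_comm _ a, integral_const_mul, h, mul_zero]
  obtain ⟨B, hB⟩ := isCompact_Icc.exists_bound_of_continuousOn (s := Set.Icc 0 Real.pi)
    hg.continuousOn
  have hpi := Real.pi_pos
  have hB0 : 0 ≤ B := (norm_nonneg _).trans (hB 0 ⟨le_rfl, hpi.le⟩)
  have hsq : ∫ t in (0 : ℝ)..Real.pi, g t * g t = 0 := by
    have hle : ∀ ε > 0, |∫ t in (0 : ℝ)..Real.pi, g t * g t| ≤ ε := by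
      intro ε hε
      obtain ⟨p, hp⟩ := exists_polynomial_near_of_continuousOn (-1) 1
        (fun x => g (Real.arccos x)) (hg.comp Real.continuous_arccos).continuousOn
        (ε / (B * Real.pi + 1)) (by positivity)
      have heq : ∫ t in (0 : ℝ)..Real.pi, g t * g t =
          ∫ t in (0 : ℝ)..Real.pi, g t * (g t - p.eval (Real.cos t)) := by
        simp_rw [mul_sub]
        rw [integral_sub (Continuous.intervalIntegrable (by fun_prop) _ _)
          (Continuous.intervalIntegrable (by fun_prop) _ _), hpoly, sub_zero]
      rw [heq, ← Real.norm_eq_abs]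
      have hb : ‖∫ t in (0 : ℝ)..Real.pi, g t * (g t - p.eval (Real.cos t))‖ ≤
          B * (ε / (B * Real.pi + 1)) * |Real.pi - 0| := by
        refine norm_integral_le_of_norm_le_const fun t ht => ?_
        rw [Set.uIoc_of_le hpi.le] at ht
        have h1 := hp (Real.cos t) ⟨Real.neg_one_le_cos t, Real.cos_le_one t⟩
        rw [Real.arccos_cos ht.1.le ht.2, abs_sub_comm] at h1
        rw [norm_mul]
        exact mul_le_mul (hB t ⟨ht.1.le, ht.2⟩) h1.le (norm_nonneg _) hB0
      refine hb.trans ?_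
      rw [sub_zero, abs_of_pos hpi, mul_div_assoc', div_mul_eq_mul_div, div_le_iff₀ (by positivity)]
      nlinarith
    exact abs_eq_zero.mp (le_antisymm (le_of_forall_gt_imp_ge_of_dense fun ε hε => hle ε hε)
      (abs_nonneg _))
  have hzero : ∀ s ∈ Set.Icc 0 Real.pi, g s = 0 := by
    by_contra! hne
    obtain ⟨s, hs, hgs⟩ := hne
    have := integral_pos hpi (f := fun t => g t * g t) (by fun_prop)
      (fun t _ => mul_self_nonneg _) ⟨s, hs, mul_self_pos.mpr hgs⟩
    exact this.ne' hsq
  have hcos : Real.cos (Real.arccos (Real.cos t)) = Real.cos t :=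
    Real.cos_arccos (Real.neg_one_le_cos t) (Real.cos_le_one t)
  have h1 := hzero _ ⟨Real.arccos_nonneg (Real.cos t), Real.arccos_le_pi _⟩
  obtain ⟨k, hk | hk⟩ := Real.cos_eq_cos_iff.mp hcos
  · have h2 := hper.int_mul k (Real.arccos (Real.cos t))
    rw [hk, ← h1, ← h2]
    ring_nf
  · have h2 := hper.int_mul k (-Real.arccos (Real.cos t))
    rw [heven, h1] at h2
    rw [hk, ← h2]
    ring_nf

theorem periodic_primitive {f : ℝ → ℝ} (hf : Continuous f)
    (hper : Function.Periodic f (2 * Real.pi))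
    (h0 : ∫ t in (-Real.pi)..Real.pi, f t = 0) :
    Function.Periodic (fun t => ∫ s in (0 : ℝ)..t, f s) (2 * Real.pi) := by
  intro t
  have h1 := hper.intervalIntegral_add_eq t (-Real.pi)
  rw [show -Real.pi + 2 * Real.pi = Real.pi by ring, h0] at h1
  have h2 := integral_add_adjacent_intervals (hf.intervalIntegrable (μ := MeasureTheory.volume) 0 t)
    (hf.intervalIntegrable t (t + 2 * Real.pi))
  simp only
  linarith

/-- If the cosine coefficients of a continuous even periodic function `H` are `-j² c_j`, then the
cosine series with coefficients `c_j` is twice continuously differentiable with second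
derivative `H`. -/
theorem hasDerivAt_cosSeries {c : ℕ → ℝ} {M : ℝ} (hc : ∀ j, |c j| ≤ M / (1 + (j : ℝ) ^ 2))
    {H : ℝ → ℝ} (hH : Continuous H) (heven : ∀ t, H (-t) = H t)
    (hper : Function.Periodic H (2 * Real.pi))
    (hcoeff : ∀ j : ℕ, cosCoeff H j = -(j : ℝ) ^ 2 * c j) :
    ∃ D : ℝ → ℝ, (∀ t, HasDerivAt (cosSeries c) (D t) t) ∧ ∀ t, HasDerivAt D (H t) t := by
  have hpi := Real.pi_pos
  set D : ℝ → ℝ := fun t => ∫ s in (0 : ℝ)..t, H s with hD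
  have hDder : ∀ t, HasDerivAt D (H t) t := fun t => hH.integral_hasStrictDerivAt 0 t |>.hasDerivAt
  have hDcont : Continuous D := continuous_iff_continuousAt.mpr fun t => (hDder t).continuousAt
  set Y : ℝ → ℝ := fun t => ∫ s in (0 : ℝ)..t, D s with hY
  have hYder : ∀ t, HasDerivAt Y (D t) t :=
    fun t => hDcont.integral_hasStrictDerivAt 0 t |>.hasDerivAt
  have hYcont : Continuous Y := continuous_iff_continuousAt.mpr fun t => (hYder t).continuousAt
  have hDodd : ∀ t, D (-t) = -D t := by
    intro t
    have h := integral_comp_neg (a := 0) (b := t) H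
    simp only [heven, neg_zero] at h
    simp only [hD]
    rw [h, integral_symm]
  have hYeven : ∀ t, Y (-t) = Y t := by
    intro t
    have h := integral_comp_neg (a := 0) (b := t) D
    simp only [hDodd, neg_zero, intervalIntegral.integral_neg] at h
    simp only [hY]
    rw [integral_symm, ← h, neg_neg]
  have hDpi : D Real.pi = 0 := by
    have h := hcoeff 0
    simp only [cosCoeff, Nat.cast_zero, zero_mul, Real.cos_zero, mul_one] at h
    norm_num at h
    exact h
  have hDper : Function.Periodic D (2 * Real.pi) := by
    refine periodic_primitive hH hper ?_
    have h := integral_add_adjacent_intervals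
      (hH.intervalIntegrable (μ := MeasureTheory.volume) (-Real.pi) 0)
      (hH.intervalIntegrable 0 Real.pi)
    have h1 := hDodd Real.pi
    simp only [hD] at h1 hDpi
    rw [integral_symm] at h1
    linarith
  have hYper : Function.Periodic Y (2 * Real.pi) := by
    refine periodic_primitive hDcont hDper ?_
    have h := integral_add_adjacent_intervals
      (hDcont.intervalIntegrable (μ := MeasureTheory.volume) (-Real.pi) 0)
      (hDcont.intervalIntegrable 0 Real.pi)
    have h1 := hYeven Real.pi
    simp only [hY] at h1
    rw [integral_symm] at h1
    linarith
  have hYcoeff : ∀ j : ℕ, j ≠ 0 → cosCoeff Y j = c j := by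
    intro j hj
    have hj' : (j : ℝ) ≠ 0 := Nat.cast_ne_zero.mpr hj
    have h1 : ∫ t in (0 : ℝ)..Real.pi, Y t * Real.cos (j * t) =
        -∫ t in (0 : ℝ)..Real.pi, D t * (Real.sin (j * t) / j) := by
      have hs : ∀ t : ℝ, HasDerivAt (fun t => Real.sin (j * t) / j) (Real.cos (j * t)) t := by
        intro t
        have := ((hasDerivAt_id t).const_mul (j : ℝ)).sin.div_const (j : ℝ)
        refine this.congr_deriv ?_
        simp
        field_simp
      rw [integral_mul_deriv_eq_deriv_mul (u := Y) (u' := D)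
        (v := fun t => Real.sin (j * t) / j) (v' := fun t => Real.cos (j * t))
        (fun t _ => hYder t) (fun t _ => hs t)
        (hDcont.intervalIntegrable _ _) (Continuous.intervalIntegrable (by fun_prop) _ _)]
      simp [Real.sin_nat_mul_pi]
    have h2 : ∫ t in (0 : ℝ)..Real.pi, D t * (Real.sin (j * t) / j) =
        -∫ t in (0 : ℝ)..Real.pi, H t * (-(Real.cos (j * t) / (j : ℝ) ^ 2)) := by
      have hs : ∀ t : ℝ, HasDerivAt (fun t => -(Real.cos (j * t) / (j : ℝ) ^ 2))
          (Real.sin (j * t) / j) t := by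
        intro t
        have := (((hasDerivAt_id t).const_mul (j : ℝ)).cos.div_const ((j : ℝ) ^ 2)).neg
        refine this.congr_deriv ?_
        simp
        field_simp
      rw [integral_mul_deriv_eq_deriv_mul (u := D) (u' := H)
        (v := fun t => -(Real.cos (j * t) / (j : ℝ) ^ 2)) (v' := fun t => Real.sin (j * t) / j)
        (fun t _ => hDder t) (fun t _ => hs t)
        (hH.intervalIntegrable _ _) (Continuous.intervalIntegrable (by fun_prop) _ _)]
      have hD0 : D 0 = 0 := by simp [hD]
      simp [hDpi, hD0]
    have h3 : ∫ t in (0 : ℝ)..Real.pi, H t * (-(Real.cos (j * t) / (j : ℝ) ^ 2)) =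
        -(1 / (j : ℝ) ^ 2) * ∫ t in (0 : ℝ)..Real.pi, H t * Real.cos (j * t) := by
      rw [← integral_const_mul]
      congr 1
      ext t
      ring
    have h4 := hcoeff j
    unfold cosCoeff at h4 ⊢
    rw [h1, h2, h3]
    calc _ = -(1 / (j : ℝ) ^ 2) * ((if j = 0 then 1 else 2) / Real.pi *
          ∫ t in (0 : ℝ)..Real.pi, H t * Real.cos (j * t)) := by ring
      _ = c j := by rw [h4]; field_simp
  set e : ℝ := c 0 - cosCoeff Y 0 with he
  have hconst : Continuous fun _ : ℝ => e := continuous_const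
  have hcs := continuous_cosSeries hc
  have hdiff : ∀ t, cosSeries c t - (Y t + e) = 0 := by
    refine eq_zero_of_cosCoeff_eq_zero (g := fun t => cosSeries c t - (Y t + e))
      (by fun_prop) (fun t => ?_) (fun t => ?_) (fun j => ?_)
    · rw [cosSeries_neg, hYeven]
    · simp only
      rw [periodic_cosSeries c t, hYper t]
    · rw [cosCoeff_sub hcs (g := fun t => Y t + e) (by fun_prop), cosCoeff_add hYcont hconst, cosCoeff_cosSeries hc]
      have h5 : cosCoeff (fun _ => e) j = if 0 = j then e else 0 := by
        have := cosCoeff_const_mul e (fun t => Real.cos ((0 : ℕ) * t)) j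
        rw [cosCoeff_cos] at this
        simpa using this
      rw [h5]
      by_cases hj : j = 0
      · subst hj; simp [he]
      · rw [hYcoeff j hj]; simp [Ne.symm hj]
  refine ⟨D, fun t => ?_, hDder⟩
  have : cosSeries c = fun t => Y t + e := funext fun t => by linarith [hdiff t]
  rw [this]
  exact (hYder t).add_const e

end KleinGordon

namespace KleinGordon

/-- If `|F'| ≤ K |z|ⁿ` on `[-ρ, ρ]` and `F 0 = 0` then `|F| ≤ K |z|ⁿ⁺¹` there. -/
theorem abs_le_pow_succ_of_deriv_le {F F' : ℝ → ℝ} {ρ K : ℝ} {n : ℕ} (hK : 0 ≤ K)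
    (hF : ∀ z, |z| ≤ ρ → HasDerivAt F (F' z) z) (hF0 : F 0 = 0)
    (hb : ∀ z, |z| ≤ ρ → |F' z| ≤ K * |z| ^ n) :
    ∀ z, |z| ≤ ρ → |F z| ≤ K * |z| ^ (n + 1) := by
  intro z hz
  have h := Convex.norm_image_sub_le_of_norm_hasDerivWithin_le (f := F) (f' := F')
    (s := Set.Icc (-|z|) |z|) (x := 0) (y := z) (C := K * |z| ^ n)
    (fun x hx => (hF x ((abs_le.mpr hx).trans hz)).hasDerivWithinAt)
    (fun x hx => by
      have hx' : |x| ≤ |z| := abs_le.mpr hx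
      rw [Real.norm_eq_abs]
      exact (hb x (hx'.trans hz)).trans (by gcongr))
    (convex_Icc _ _) ⟨by simp, by simp⟩ (abs_le.mp le_rfl)
  rw [hF0, sub_zero, sub_zero, Real.norm_eq_abs, Real.norm_eq_abs] at h
  rwa [pow_succ, ← mul_assoc]

/-- The force of a `C⁶` potential with `V'(0) = 0`, `V''(0) = 1` is, near `0`, a cubic polynomial
plus a globally defined remainder of fourth order. -/
theorem exists_cubic_expansion (V : ℝ → ℝ) (hV : ∃ r > (0 : ℝ), ContDiffOn ℝ 6 V (Metric.ball 0 r))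
    (hV1 : deriv V 0 = 0) (hV2 : iteratedDeriv 2 V 0 = 1) :
    ∃ ρ > (0 : ℝ), ∃ K ≥ (0 : ℝ), ∃ T : ℝ → ℝ, T 0 = 0 ∧
      (∀ z z' R, |z| ≤ R → |z'| ≤ R → |T z - T z'| ≤ K * R ^ 3 * |z - z'|) ∧
      ∀ z, |z| ≤ ρ → deriv V z =
        z + (iteratedDeriv 3 V 0 / 2 * z ^ 2 + iteratedDeriv 4 V 0 / 6 * z ^ 3 + T z) := by
  obtain ⟨r, hr, hV⟩ := hV
  have hopen : IsOpen (Metric.ball (0 : ℝ) r) := Metric.isOpen_ball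
  have hcont : ∀ n : ℕ, n ≤ 5 → ContinuousOn (iteratedDeriv n V) (Metric.ball 0 r) := by
    intro n hn
    refine (hV.continuousOn_iteratedDerivWithin (m := n) ?_ hopen.uniqueDiffOn).congr
      fun z hz => (iteratedDerivWithin_of_isOpen hopen hz).symm
    exact_mod_cast hn.trans (by norm_num : 5 ≤ 6)
  set ρ := r / 2 with hρ
  have hρ0 : 0 < ρ := by positivity
  have hsub : ∀ z : ℝ, |z| ≤ ρ → z ∈ Metric.ball (0 : ℝ) r := by
    intro z hz
    rw [mem_ball_zero_iff, Real.norm_eq_abs]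
    linarith
  have hder : ∀ n : ℕ, n ≤ 4 → ∀ z : ℝ, |z| ≤ ρ →
      HasDerivAt (iteratedDeriv n V) (iteratedDeriv (n + 1) V z) z := by
    intro n hn z hz
    have h1 : DifferentiableOn ℝ (iteratedDeriv n V) (Metric.ball 0 r) := by
      refine (hV.differentiableOn_iteratedDerivWithin (m := n) ?_ hopen.uniqueDiffOn).congr
        fun z hz => (iteratedDerivWithin_of_isOpen hopen hz).symm
      exact_mod_cast hn.trans_lt (by norm_num : 4 < 6)
    rw [iteratedDeriv_succ]
    exact (h1.differentiableAt (hopen.mem_nhds (hsub z hz))).hasDerivAt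
  obtain ⟨K, hK⟩ := (isCompact_Icc (a := -ρ) (b := ρ)).exists_bound_of_continuousOn
    ((hcont 5 le_rfl).mono fun z hz => hsub z (abs_le.mpr hz))
  have hK0 : 0 ≤ K := (norm_nonneg _).trans (hK 0 ⟨by linarith, by linarith⟩)
  set α := iteratedDeriv 3 V 0 with hα
  set β := iteratedDeriv 4 V 0 with hβ
  have hb4 := abs_le_pow_succ_of_deriv_le (F := fun z => iteratedDeriv 4 V z - β)
    (F' := iteratedDeriv 5 V) (ρ := ρ) (K := K) (n := 0) hK0
    (fun z hz => (hder 4 (by norm_num) z hz).sub_const _) (by simp [hβ])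
    (fun z hz => by simpa using hK z (abs_le.mp hz))
  have hb3 := abs_le_pow_succ_of_deriv_le (F := fun z => iteratedDeriv 3 V z - (α + β * z))
    (F' := fun z => iteratedDeriv 4 V z - β) (ρ := ρ) (K := K) (n := 0 + 1) hK0
    (fun z hz => by
      refine (hder 3 (by norm_num) z hz).sub ?_
      simpa using ((hasDerivAt_id z).const_mul β).const_add α) (by simp [hα]) hb4
  have hb2 := abs_le_pow_succ_of_deriv_le
    (F := fun z => iteratedDeriv 2 V z - (1 + α * z + β / 2 * z ^ 2))
    (F' := fun z => iteratedDeriv 3 V z - (α + β * z)) (ρ := ρ) (K := K) (n := 0 + 1 + 1) hK0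
    (fun z hz => by
      refine (hder 2 (by norm_num) z hz).sub ?_
      refine ((((hasDerivAt_id z).const_mul α).const_add 1).add
        ((hasDerivAt_pow 2 z).const_mul (β / 2))).congr_deriv ?_
      simp
      ring) (by simp [hV2]) hb3
  set G : ℝ → ℝ := fun z => deriv V z - (z + (α / 2 * z ^ 2 + β / 6 * z ^ 3)) with hG
  have hG1 : ∀ z, |z| ≤ ρ →
      HasDerivAt G (iteratedDeriv 2 V z - (1 + α * z + β / 2 * z ^ 2)) z := by
    intro z hz
    have h1 := hder 1 (by norm_num) z hz
    rw [iteratedDeriv_one] at h1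
    refine h1.sub ?_
    refine ((hasDerivAt_id z).add (((hasDerivAt_pow 2 z).const_mul (α / 2)).add
        ((hasDerivAt_pow 3 z).const_mul (β / 6)))).congr_deriv ?_
    simp
    ring
  have hGlip : ∀ z z' R, R ≤ ρ → |z| ≤ R → |z'| ≤ R → |G z - G z'| ≤ K * R ^ 3 * |z - z'| := by
    intro z z' R hR hz hz'
    have h := Convex.norm_image_sub_le_of_norm_hasDerivWithin_le (f := G)
      (s := Set.Icc (-R) R) (x := z') (y := z) (C := K * R ^ 3)
      (fun x hx => (hG1 x ((abs_le.mpr hx).trans hR)).hasDerivWithinAt)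
      (fun x hx => by
        have hx' : |x| ≤ R := abs_le.mpr hx
        rw [Real.norm_eq_abs]
        exact (hb2 x (hx'.trans hR)).trans (by gcongr))
      (convex_Icc _ _) (abs_le.mp hz') (abs_le.mp hz)
    simpa [Real.norm_eq_abs] using h
  have hρρ : -ρ ≤ ρ := by linarith
  have hproj : ∀ z : ℝ, |z| ≤ ρ → (Set.projIcc (-ρ) ρ hρρ z : ℝ) = z := by
    intro z hz
    rw [Set.projIcc_of_mem hρρ (abs_le.mp hz)]
  have hproj_le : ∀ z : ℝ, |(Set.projIcc (-ρ) ρ hρρ z : ℝ)| ≤ |z| := by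
    intro z
    have h := Set.abs_projIcc_sub_projIcc (c := z) (d := 0) hρρ
    rwa [hproj 0 (by simpa using hρ0.le), sub_zero, sub_zero] at h
  refine ⟨ρ, hρ0, K, hK0, fun z => G (Set.projIcc (-ρ) ρ hρρ z), ?_, ?_, ?_⟩
  · simp only
    rw [hproj 0 (by simpa using hρ0.le)]
    simp [hG, hV1]
  · intro z z' R hz hz'
    have hR : 0 ≤ R := (abs_nonneg z).trans hz
    have h1 := hGlip (Set.projIcc (-ρ) ρ hρρ z) (Set.projIcc (-ρ) ρ hρρ z') (min R ρ)
      (min_le_right _ _)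
      (le_min ((hproj_le z).trans hz) (abs_le.mpr (Set.projIcc (-ρ) ρ hρρ z).2))
      (le_min ((hproj_le z').trans hz') (abs_le.mpr (Set.projIcc (-ρ) ρ hρρ z').2))
    refine h1.trans ?_
    have h2 : 0 ≤ min R ρ := le_min hR hρ0.le
    refine mul_le_mul ?_ ?_ (abs_nonneg _) (by positivity)
    · gcongr
      exact min_le_left _ _
    · exact Set.abs_projIcc_sub_projIcc hρρ
  · intro z hz
    simp only [hproj z hz, hG]
    ring

end KleinGordon

namespace KleinGordon

open Real

/-- The odd bounded solution of the linearized Ablowitz-Ladik equation. -/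
noncomputable def oddMode (θ : ℝ) : ℝ := sinh θ / cosh θ ^ 2

/-- The even unbounded solution of the linearized Ablowitz-Ladik equation. -/
noncomputable def evenMode (κ θ : ℝ) : ℝ :=
  (sinh θ ^ 2 / 2 - cosh κ ^ 2) / cosh θ + 3 / 2 * (sinh κ * cosh κ / κ) * (θ * oddMode θ)

/-- The squared profile of the Ablowitz-Ladik soliton. -/
noncomputable def profileSq (κ θ : ℝ) : ℝ := (sinh κ / cosh θ) ^ 2

/-- The potential of the linearized Ablowitz-Ladik equation. -/
noncomputable def linPot (κ θ : ℝ) : ℝ :=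
  2 * cosh κ * (1 - profileSq κ θ) / (1 + profileSq κ θ) ^ 2

theorem cosh_add_mul_cosh_sub (θ κ : ℝ) :
    cosh (θ + κ) * cosh (θ - κ) = cosh θ ^ 2 + sinh κ ^ 2 := by
  rw [cosh_add, cosh_sub]
  linear_combination (cosh θ ^ 2) * cosh_sq κ - (sinh κ ^ 2) * sinh_sq θ

theorem inv_cosh_add (κ θ : ℝ) : 1 / cosh (θ + κ) + 1 / cosh (θ - κ) =
    2 * cosh κ / (1 + profileSq κ θ) * (1 / cosh θ) := by
  have h0 := (cosh_pos θ).ne'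
  have h1 := (cosh_pos (θ + κ)).ne'
  have h2 := (cosh_pos (θ - κ)).ne'
  have h3 : 1 + profileSq κ θ = cosh (θ + κ) * cosh (θ - κ) / cosh θ ^ 2 := by
    rw [cosh_add_mul_cosh_sub, profileSq]
    field_simp
  rw [h3]
  field_simp
  rw [cosh_add, cosh_sub]
  ring

theorem linPot_eq (κ θ : ℝ) : linPot κ θ =
    2 * cosh κ * (cosh θ ^ 2 - sinh κ ^ 2) * cosh θ ^ 2 / (cosh (θ + κ) * cosh (θ - κ)) ^ 2 := by
  have h0 := (cosh_pos θ).ne'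
  have h1 : cosh θ ^ 2 + sinh κ ^ 2 ≠ 0 := by have := cosh_pos θ; positivity
  rw [cosh_add_mul_cosh_sub, linPot, profileSq]
  field_simp

theorem oddMode_recurrence (κ θ : ℝ) :
    oddMode (θ + κ) + oddMode (θ - κ) = linPot κ θ * oddMode θ := by
  have h0 := (cosh_pos θ).ne'
  have h1 := (cosh_pos (θ + κ)).ne'
  have h2 := (cosh_pos (θ - κ)).ne'
  rw [linPot_eq, oddMode, oddMode, oddMode]
  field_simp
  rw [cosh_add, cosh_sub, sinh_add, sinh_sub]
  have e1 := cosh_sq θ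
  have e2 := cosh_sq κ
  generalize cosh θ = C at *
  generalize cosh κ = c at *
  generalize sinh θ = S at *
  generalize sinh κ = s at *
  grind

theorem evenMode_recurrence {κ : ℝ} (hκ : κ ≠ 0) (θ : ℝ) :
    evenMode κ (θ + κ) + evenMode κ (θ - κ) = linPot κ θ * evenMode κ θ := by
  have hr := oddMode_recurrence κ θ
  have key : (sinh (θ + κ) ^ 2 / 2 - cosh κ ^ 2) / cosh (θ + κ) +
      (sinh (θ - κ) ^ 2 / 2 - cosh κ ^ 2) / cosh (θ - κ) +
      3 / 2 * (sinh κ * cosh κ) * (oddMode (θ + κ) - oddMode (θ - κ)) =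
      linPot κ θ * ((sinh θ ^ 2 / 2 - cosh κ ^ 2) / cosh θ) := by
    have h0 := (cosh_pos θ).ne'
    have h1 := (cosh_pos (θ + κ)).ne'
    have h2 := (cosh_pos (θ - κ)).ne'
    rw [linPot_eq, oddMode, oddMode]
    field_simp
    rw [cosh_add, cosh_sub, sinh_add, sinh_sub]
    have e1 := cosh_sq θ
    have e2 := cosh_sq κ
    generalize cosh θ = C at *
    generalize cosh κ = c at *
    generalize sinh θ = S at *
    generalize sinh κ = s at *
    grind
  unfold evenMode
  have h3 : 3 / 2 * (sinh κ * cosh κ / κ) * κ = 3 / 2 * (sinh κ * cosh κ) := by field_simp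
  linear_combination key + 3 / 2 * (sinh κ * cosh κ / κ) * θ * hr +
    (oddMode (θ + κ) - oddMode (θ - κ)) * h3

theorem wronskian_modes {κ : ℝ} (hκ : κ ≠ 0) (θ : ℝ) :
    oddMode θ * evenMode κ (θ + κ) - oddMode (θ + κ) * evenMode κ θ = sinh κ := by
  have h3 : 3 / 2 * (sinh κ * cosh κ / κ) * κ = 3 / 2 * (sinh κ * cosh κ) := by field_simp
  have key : oddMode θ * ((sinh (θ + κ) ^ 2 / 2 - cosh κ ^ 2) / cosh (θ + κ)) -
      oddMode (θ + κ) * ((sinh θ ^ 2 / 2 - cosh κ ^ 2) / cosh θ) +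
      3 / 2 * (sinh κ * cosh κ) * (oddMode θ * oddMode (θ + κ)) = sinh κ := by
    have h0 := (cosh_pos θ).ne'
    have h1 := (cosh_pos (θ + κ)).ne'
    rw [oddMode, oddMode]
    field_simp
    rw [cosh_add, sinh_add]
    have e1 := cosh_sq θ
    have e2 := cosh_sq κ
    generalize cosh θ = C at *
    generalize cosh κ = c at *
    generalize sinh θ = S at *
    generalize sinh κ = s at *
    grind
  unfold evenMode
  linear_combination key + oddMode θ * oddMode (θ + κ) * h3

theorem oddMode_neg (θ : ℝ) : oddMode (-θ) = -oddMode θ := by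
  simp [oddMode, neg_div]

theorem evenMode_neg (κ θ : ℝ) : evenMode κ (-θ) = evenMode κ θ := by
  simp [evenMode, oddMode_neg]

theorem sinh_le_two_mul {κ : ℝ} (h0 : 0 ≤ κ) (h1 : κ ≤ 1) : sinh κ ≤ 2 * κ := by
  have h2 := abs_le.mp (abs_exp_sub_one_le (x := κ) (by rwa [abs_of_nonneg h0]))
  have h3 := abs_le.mp (abs_exp_sub_one_le (x := -κ) (by rwa [abs_neg, abs_of_nonneg h0]))
  rw [abs_of_nonneg h0] at h2
  rw [abs_neg, abs_of_nonneg h0] at h3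
  rw [sinh_eq]
  linarith [h2.2, h3.1]

theorem cosh_le_two {κ : ℝ} (h0 : 0 ≤ κ) (h1 : κ ≤ 1) : cosh κ ≤ 2 := by
  have h2 : exp κ ≤ exp 1 := exp_le_exp.mpr h1
  have h3 : exp (-κ) ≤ 1 := exp_le_one_iff.mpr (by linarith)
  rw [cosh_eq]
  linarith [exp_one_lt_d9]

theorem cosh_sub_one_le {κ : ℝ} (h0 : 0 ≤ κ) (h1 : κ ≤ 1) : cosh κ - 1 ≤ 2 * κ ^ 2 := by
  have h2 := sinh_le_two_mul (κ := κ / 2) (by linarith) (by linarith)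
  have h3 : 0 ≤ sinh (κ / 2) := sinh_nonneg_iff.mpr (by linarith)
  have h4 : cosh κ = 2 * sinh (κ / 2) ^ 2 + 1 := by
    rw [show κ = 2 * (κ / 2) by ring, cosh_two_mul, cosh_sq, show 2 * (κ / 2) / 2 = κ / 2 by ring]
    ring
  nlinarith

theorem abs_sinh_le_cosh (θ : ℝ) : |sinh θ| ≤ cosh θ :=
  abs_le_of_sq_le_sq (by rw [cosh_sq]; linarith) (cosh_pos θ).le

theorem inv_cosh_le {θ : ℝ} : 1 / cosh θ ≤ 2 * exp (-θ) := by
  rw [div_le_iff₀ (cosh_pos θ), cosh_eq, exp_neg]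
  have := exp_pos θ
  field_simp
  nlinarith [sq_nonneg (exp θ)⁻¹]

theorem abs_oddMode_le (θ : ℝ) : |oddMode θ| ≤ 1 / cosh θ := by
  have h := cosh_pos θ
  rw [oddMode, abs_div, abs_of_pos (pow_pos h 2), div_le_div_iff₀ (pow_pos h 2) h]
  nlinarith [abs_sinh_le_cosh θ]

theorem abs_evenMode_le {κ : ℝ} (h0 : 0 < κ) (h1 : κ ≤ 1) {θ : ℝ} (hθ : 0 ≤ θ) :
    |evenMode κ θ| ≤ 11 * exp θ := by
  have hc := cosh_pos θ
  have hc1 := one_le_cosh θ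
  have hκ := cosh_le_two h0.le h1
  have hκ1 := one_le_cosh κ
  have hs := sinh_le_two_mul h0.le h1
  have hs0 : 0 ≤ sinh κ := sinh_nonneg_iff.mpr h0.le
  have hse : cosh θ ≤ exp θ := by
    rw [cosh_eq]
    linarith [exp_le_exp.mpr (by linarith : -θ ≤ θ)]
  have hA : |(sinh θ ^ 2 / 2 - cosh κ ^ 2) / cosh θ| ≤ 4 * cosh θ := by
    rw [abs_div, abs_of_pos hc, div_le_iff₀ hc, abs_le]
    have := cosh_sq θ
    constructor <;> nlinarith [sq_nonneg (sinh θ)]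
  have hB0 : 0 ≤ sinh κ * cosh κ / κ := by positivity
  have hB : sinh κ * cosh κ / κ ≤ 4 := by
    rw [div_le_iff₀ h0]
    nlinarith
  have hC : |θ * oddMode θ| ≤ cosh θ := by
    rw [abs_mul, abs_of_nonneg hθ]
    have h2 : θ ≤ cosh θ := (self_le_sinh_iff.mpr hθ).trans (sinh_lt_cosh θ).le
    have h3 : |oddMode θ| ≤ 1 := (abs_oddMode_le θ).trans (by rw [div_le_one hc]; exact hc1)
    nlinarith [abs_nonneg (oddMode θ)]
  calc |evenMode κ θ| ≤ |(sinh θ ^ 2 / 2 - cosh κ ^ 2) / cosh θ| +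
        |3 / 2 * (sinh κ * cosh κ / κ) * (θ * oddMode θ)| := abs_add_le _ _
    _ ≤ 4 * cosh θ + 3 / 2 * 4 * cosh θ := by
        rw [abs_mul, abs_of_nonneg (by positivity : 0 ≤ 3 / 2 * (sinh κ * cosh κ / κ))]
        gcongr
    _ ≤ 11 * exp θ := by linarith

/-- Phase of the `i`-th site of the half-lattice; `c` tells whether the centre of symmetry is
midway between two sites. -/
noncomputable def phase (c : Bool) (κ : ℝ) (i : ℕ) : ℝ := κ * (i + if c then 1 / 2 else 0)

/-- Left neighbour of the `i`-th site of the half-lattice, after reflection. -/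
def left (c : Bool) : ℕ → ℕ
  | 0 => if c then 0 else 1
  | i + 1 => i

theorem phase_succ (c : Bool) (κ : ℝ) (i : ℕ) : phase c κ (i + 1) = phase c κ i + κ := by
  simp [phase]; ring

theorem phase_left {F : ℝ → ℝ} (hF : ∀ θ, F (-θ) = F θ) (c : Bool) (κ : ℝ) (i : ℕ) :
    F (phase c κ (left c i)) = F (phase c κ i - κ) := by
  cases i with
  | zero =>
    rw [← hF]
    cases c <;> simp [left, phase]; try ring_nf
  | succ i => rw [phase_succ, left]; simp

theorem phase_nonneg (c : Bool) {κ : ℝ} (hκ : 0 ≤ κ) (i : ℕ) : 0 ≤ phase c κ i := by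
  unfold phase; split_ifs <;> positivity

/-- The base of the exponential weight. -/
noncomputable def weightBase (κ : ℝ) : ℝ := exp (-(κ / 2))

theorem weightBase_pos (κ : ℝ) : 0 < weightBase κ := exp_pos _

theorem weightBase_lt_one {κ : ℝ} (hκ : 0 < κ) : weightBase κ < 1 :=
  exp_lt_one_iff.mpr (by linarith)

theorem exp_neg_phase_le (c : Bool) {κ : ℝ} (hκ : 0 ≤ κ) (i : ℕ) :
    exp (-phase c κ i) ≤ (weightBase κ ^ i) ^ 2 := by
  rw [weightBase, ← exp_nat_mul, ← exp_nat_mul, exp_le_exp, phase]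
  push_cast
  have : 0 ≤ κ * (if c then 1 / 2 else 0 : ℝ) := by split_ifs <;> positivity
  linarith

theorem exp_phase_le (c : Bool) {κ : ℝ} (h1 : κ ≤ 1) (i : ℕ) :
    (weightBase κ ^ i) ^ 2 * exp (phase c κ i) ≤ 2 := by
  rw [weightBase, ← exp_nat_mul, ← exp_nat_mul, ← exp_add, phase]
  have h2 : κ * (if c then 1 / 2 else 0 : ℝ) ≤ 1 / 2 := by
    split_ifs
    · linarith
    · linarith
  have h3 : exp (1 / 2) ≤ 2 := by
    have h4 : exp (1 / 2) * exp (1 / 2) = exp 1 := by rw [← exp_add]; norm_num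
    nlinarith [exp_one_lt_d9, exp_pos (1 / 2 : ℝ)]
  refine le_trans (exp_le_exp.mpr ?_) h3
  push_cast
  linarith

theorem le_one_sub_weightBase {κ : ℝ} (h0 : 0 ≤ κ) (h1 : κ ≤ 1) : κ / 3 ≤ 1 - weightBase κ := by
  have h2 := add_one_le_exp (κ / 2)
  have h3 : weightBase κ * exp (κ / 2) = 1 := by rw [weightBase, ← exp_add]; simp
  have h4 := weightBase_pos κ
  nlinarith

end KleinGordon

namespace KleinGordon

open Real Finset

/-- Weight of the `m`-th site of the half-lattice in sums over the symmetric lattice. -/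
noncomputable def siteWeight (c : Bool) (m : ℕ) : ℝ := if m = 0 ∧ c = false then 1 / 2 else 1

/-- The symmetric decaying solution `v` of `v_{n+1} + v_{n-1} - W_n v_n = f_n`, on the
half-lattice. -/
noncomputable def green (c : Bool) (κ : ℝ) (f : ℕ → ℝ) (i : ℕ) : ℝ :=
  -(evenMode κ (phase c κ i) * ∑' m, oddMode (phase c κ (m + (i + 1))) * f (m + (i + 1)) +
    oddMode (phase c κ i) *
      ∑ m ∈ range (i + 1), siteWeight c m * (evenMode κ (phase c κ m) * f m)) / sinh κ

theorem abs_oddMode_phase_le (c : Bool) {κ : ℝ} (h0 : 0 ≤ κ) (i : ℕ) :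
    |oddMode (phase c κ i)| ≤ 2 * (weightBase κ ^ i) ^ 2 :=
  (abs_oddMode_le _).trans (inv_cosh_le.trans (by gcongr; exact exp_neg_phase_le c h0 i))

theorem abs_evenMode_phase_le (c : Bool) {κ : ℝ} (h0 : 0 < κ) (h1 : κ ≤ 1) (i : ℕ) :
    (weightBase κ ^ i) ^ 2 * |evenMode κ (phase c κ i)| ≤ 22 := by
  have h2 := abs_evenMode_le h0 h1 (phase_nonneg c h0.le i)
  have h3 := exp_phase_le c h1 i
  have h4 := weightBase_pos κ
  calc _ ≤ (weightBase κ ^ i) ^ 2 * (11 * exp (phase c κ i)) := by gcongr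
    _ ≤ 22 := by linarith

section
variable {κ : ℝ} (h0 : 0 < κ) (h1 : κ ≤ 1) {f : ℕ → ℝ} {M : ℝ}
  (hf : ∀ i, |f i| ≤ M * weightBase κ ^ i)

section
include h0 hf

theorem abs_oddMode_mul_le (c : Bool) (i : ℕ) (m : ℕ) :
    |oddMode (phase c κ (m + (i + 1))) * f (m + (i + 1))| ≤
      2 * M * (weightBase κ ^ i) ^ 3 * weightBase κ ^ m := by
  have hy := weightBase_pos κ
  have hy1 := (weightBase_lt_one h0).le
  have hM : 0 ≤ M := by simpa using (abs_nonneg _).trans (hf 0)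
  have hm : weightBase κ ^ m ≤ 1 := pow_le_one₀ hy.le hy1
  rw [abs_mul]
  calc _ ≤ 2 * (weightBase κ ^ (m + (i + 1))) ^ 2 * (M * weightBase κ ^ (m + (i + 1))) :=
        mul_le_mul (abs_oddMode_phase_le c h0.le _) (hf _) (abs_nonneg _) (by positivity)
    _ = 2 * M * (weightBase κ ^ i) ^ 3 * weightBase κ ^ m *
        (weightBase κ ^ 3 * (weightBase κ ^ m) ^ 2) := by ring
    _ ≤ 2 * M * (weightBase κ ^ i) ^ 3 * weightBase κ ^ m * 1 := by
        gcongr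
        exact mul_le_one₀ (pow_le_one₀ hy.le hy1) (by positivity) (pow_le_one₀ (by positivity) hm)
    _ = _ := by ring

theorem summable_oddMode_mul (c : Bool) (i : ℕ) :
    Summable fun m => oddMode (phase c κ (m + (i + 1))) * f (m + (i + 1)) :=
  Summable.of_norm_bounded
    ((summable_geometric_of_lt_one (weightBase_pos κ).le (weightBase_lt_one h0)).mul_left _)
    (abs_oddMode_mul_le h0 hf c i)

theorem tsum_oddMode_mul (c : Bool) (i : ℕ) :
    ∑' m, oddMode (phase c κ (m + (i + 1))) * f (m + (i + 1)) =
      oddMode (phase c κ (i + 1)) * f (i + 1) +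
      ∑' m, oddMode (phase c κ (m + (i + 1 + 1))) * f (m + (i + 1 + 1)) := by
  rw [(summable_oddMode_mul h0 hf c i).tsum_eq_zero_add]
  simp only [zero_add]
  congr 2
  ext m
  rw [show m + 1 + (i + 1) = m + (i + 1 + 1) by ring]

theorem green_recurrence (c : Bool) (i : ℕ) :
    green c κ f (i + 1) + green c κ f (left c i) - linPot κ (phase c κ i) * green c κ f i =
      f i := by
  have hs : sinh κ ≠ 0 := (sinh_pos_iff.mpr h0).ne'
  cases i with
  | zero =>
    have ho := oddMode_recurrence κ (phase c κ 0)
    have he := evenMode_recurrence h0.ne' (phase c κ 0)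
    have hw := wronskian_modes h0.ne' (phase c κ 0 - κ)
    have hP := tsum_oddMode_mul h0 hf c 0
    rw [sub_add_cancel] at hw
    rw [← phase_succ] at ho he
    cases c with
    | false =>
      have hz : phase false κ 0 = 0 := by simp [phase]
      have hz1 : phase false κ (0 + 1) = κ := by simp [phase]
      rw [hz] at hw
      rw [hz, hz1] at ho he
      rw [hz1] at hP
      rw [zero_sub, oddMode_neg] at ho hw
      rw [zero_sub, evenMode_neg] at he
      have ho0 : oddMode 0 = 0 := by simp [oddMode]
      simp only [left, Bool.false_eq_true, if_false, green]
      rw [hP, Finset.sum_range_succ _ (0 + 1), zero_add, Finset.sum_range_one, hz]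
      have hz2 : phase false κ 1 = κ := by simp [phase]
      rw [zero_add] at hz1
      simp only [hz2, siteWeight]
      rw [ho0] at hw ho ⊢
      simp only [zero_add] at *
      field_simp
      norm_num
      grind
    | true =>
      have hz : phase true κ 0 - κ = -phase true κ 0 := by simp [phase]; ring
      rw [hz, oddMode_neg] at ho hw
      rw [hz, evenMode_neg] at he
      rw [evenMode_neg] at hw
      simp only [left, if_true, green]
      rw [hP, Finset.sum_range_succ _ (0 + 1), zero_add, Finset.sum_range_one]
      simp only [siteWeight, zero_add] at *
      field_simp
      norm_num
      grind
  | succ i =>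
    have ho := oddMode_recurrence κ (phase c κ (i + 1))
    have he := evenMode_recurrence h0.ne' (phase c κ (i + 1))
    have hw := wronskian_modes h0.ne' (phase c κ i)
    have hP := tsum_oddMode_mul h0 hf c i
    have hP' := tsum_oddMode_mul h0 hf c (i + 1)
    rw [← phase_succ, phase_succ c κ i, add_sub_cancel_right, ← phase_succ] at ho he
    rw [← phase_succ] at hw
    have hsw : ∀ m, siteWeight c (m + 1) = 1 := fun m => by simp [siteWeight]
    simp only [left, green]
    rw [hP, hP', Finset.sum_range_succ _ (i + 1 + 1), Finset.sum_range_succ _ (i + 1)]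
    simp only [hsw]
    field_simp
    grind
end

theorem green_sub (c : Bool) (h0 : 0 < κ) {f' : ℕ → ℝ} {M' : ℝ}
    (hf : ∀ i, |f i| ≤ M * weightBase κ ^ i)
    (hf' : ∀ i, |f' i| ≤ M' * weightBase κ ^ i) (i : ℕ) :
    green c κ f i - green c κ f' i = green c κ (fun m => f m - f' m) i := by
  unfold green
  have h2 := (summable_oddMode_mul h0 hf c i).tsum_sub (summable_oddMode_mul h0 hf' c i)
  simp_rw [mul_sub, h2, Finset.sum_sub_distrib]
  ring

include h0 h1 hf

theorem abs_green_le (c : Bool) (i : ℕ) : |green c κ f i| ≤ 264 * M / κ ^ 2 * weightBase κ ^ i := by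
  have hy := weightBase_pos κ
  have hy1 := weightBase_lt_one h0
  have hM : 0 ≤ M := by simpa using (abs_nonneg _).trans (hf 0)
  have hk := le_one_sub_weightBase h0.le h1
  set y := weightBase κ with hydef
  have hgeo : (1 - y)⁻¹ ≤ 3 / κ := by
    rw [inv_eq_one_div, div_le_div_iff₀ (by linarith) h0]
    linarith
  have hyi : 0 < y ^ i := pow_pos hy i
  have hP : |∑' m, oddMode (phase c κ (m + (i + 1))) * f (m + (i + 1))| ≤
      2 * M * (y ^ i) ^ 3 * (3 / κ) := by
    have h2 := tsum_of_norm_bounded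
      ((hasSum_geometric_of_lt_one hy.le hy1).mul_left (2 * M * (y ^ i) ^ 3))
      (fun m => (norm_eq_abs _).trans_le (abs_oddMode_mul_le h0 hf c i m))
    rw [norm_eq_abs] at h2
    exact h2.trans (by gcongr)
  have hQ : y ^ i * |∑ m ∈ range (i + 1), siteWeight c m * (evenMode κ (phase c κ m) * f m)| ≤
      22 * M * (3 / κ) := by
    calc _ ≤ y ^ i * ∑ m ∈ range (i + 1), |siteWeight c m * (evenMode κ (phase c κ m) * f m)| := by
          gcongr; exact Finset.abs_sum_le_sum_abs _ _
      _ = ∑ m ∈ range (i + 1), y ^ i * |siteWeight c m * (evenMode κ (phase c κ m) * f m)| :=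
          Finset.mul_sum _ _ _
      _ ≤ ∑ m ∈ range (i + 1), 22 * M * y ^ (i + 1 - 1 - m) := by
          refine Finset.sum_le_sum fun m hm => ?_
          have hmi : m ≤ i := Nat.lt_succ_iff.mp (Finset.mem_range.mp hm)
          have hsw : |siteWeight c m| ≤ 1 := by unfold siteWeight; split_ifs <;> norm_num
          have he := abs_evenMode_phase_le c h0 h1 m
          rw [← hydef] at he
          have hpow : y ^ i = y ^ (i - m) * y ^ m := by rw [← pow_add, Nat.sub_add_cancel hmi]
          have hym : 0 < y ^ m := pow_pos hy m
          rw [abs_mul, abs_mul]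
          calc _ ≤ y ^ i * (1 * (|evenMode κ (phase c κ m)| * (M * y ^ m))) := by
                gcongr; exact hf m
            _ = y ^ (i - m) * M * ((y ^ m) ^ 2 * |evenMode κ (phase c κ m)|) := by
                rw [hpow]; ring
            _ ≤ y ^ (i - m) * M * 22 := by gcongr
            _ = _ := by rw [Nat.add_sub_cancel]; ring
      _ = 22 * M * ∑ m ∈ range (i + 1), y ^ m := by
          rw [← Finset.mul_sum, Finset.sum_range_reflect (fun m => y ^ m) (i + 1)]
      _ ≤ 22 * M * (3 / κ) := by
          gcongr
          refine le_trans ?_ hgeo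
          exact (summable_geometric_of_lt_one hy.le hy1).sum_le_tsum _ (fun _ _ => by positivity)
            |>.trans_eq (tsum_geometric_of_lt_one hy.le hy1)
  have hs : κ ≤ sinh κ := self_le_sinh_iff.mpr h0.le
  have he := abs_evenMode_phase_le c h0 h1 i
  have ho := abs_oddMode_phase_le c h0.le i
  rw [← hydef] at he ho
  unfold green
  rw [abs_div, abs_neg, abs_of_pos (h0.trans_le hs), div_le_iff₀ (h0.trans_le hs)]
  calc _ ≤ |evenMode κ (phase c κ i)| *
        |∑' m, oddMode (phase c κ (m + (i + 1))) * f (m + (i + 1))| +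
        |oddMode (phase c κ i)| *
        |∑ m ∈ range (i + 1), siteWeight c m * (evenMode κ (phase c κ m) * f m)| := by
        rw [← abs_mul, ← abs_mul]; exact abs_add_le _ _
    _ ≤ |evenMode κ (phase c κ i)| * (2 * M * (y ^ i) ^ 3 * (3 / κ)) +
        2 * (y ^ i) ^ 2 *
        |∑ m ∈ range (i + 1), siteWeight c m * (evenMode κ (phase c κ m) * f m)| := by gcongr
    _ = 2 * M * (y ^ i) * (3 / κ) * ((y ^ i) ^ 2 * |evenMode κ (phase c κ i)|) +
        2 * y ^ i *
        (y ^ i * |∑ m ∈ range (i + 1), siteWeight c m * (evenMode κ (phase c κ m) * f m)|) := by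
        ring
    _ ≤ 2 * M * (y ^ i) * (3 / κ) * 22 + 2 * y ^ i * (22 * M * (3 / κ)) := by gcongr
    _ = 264 * M / κ ^ 2 * y ^ i * κ := by field_simp; ring
    _ ≤ 264 * M / κ ^ 2 * y ^ i * sinh κ := by gcongr

end

/-- A symmetric sequence with exponentially weighted second differences has bounded first
differences. -/
theorem abs_succ_sub_le {κ : ℝ} (h0 : 0 < κ) (h1 : κ ≤ 1) {c : Bool} {v : ℕ → ℝ} {M : ℝ}
    (hv : ∀ i, |v (i + 1) + v (left c i) - 2 * v i| ≤ M * weightBase κ ^ i) (i : ℕ) :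
    |v (i + 1) - v i| ≤ M * (3 / κ) := by
  have hy := weightBase_pos κ
  have hy1 := weightBase_lt_one h0
  have hM : 0 ≤ M := by simpa using (abs_nonneg _).trans (hv 0)
  have hk := le_one_sub_weightBase h0.le h1
  have hstep : ∀ i, |v (i + 1) - v i| ≤ M * ∑ m ∈ range (i + 1), weightBase κ ^ m := by
    intro i
    induction i with
    | zero =>
      have h := abs_le.mp (hv 0)
      rw [Finset.sum_range_one]
      rw [pow_zero] at h ⊢
      rw [abs_le]
      cases c
      · simp only [left, Bool.false_eq_true, if_false, zero_add] at h ⊢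
        constructor <;> linarith [h.1, h.2]
      · simp only [left, if_true, zero_add] at h ⊢
        constructor <;> linarith [h.1, h.2]
    | succ i ih =>
      have h := abs_le.mp (hv (i + 1))
      have h' := abs_le.mp ih
      rw [Finset.sum_range_succ, mul_add, abs_le]
      simp only [left] at h
      constructor <;> linarith [h.1, h.2, h'.1, h'.2]
  refine (hstep i).trans ?_
  gcongr
  refine ((summable_geometric_of_lt_one hy.le hy1).sum_le_tsum _ (fun _ _ => by positivity)).trans ?_
  rw [tsum_geometric_of_lt_one hy.le hy1, inv_eq_one_div, div_le_div_iff₀ (by linarith) h0]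
  linarith

end KleinGordon

namespace KleinGordon

open Real

/-- The arguments on which the terms of the reduced equation depend: a small parameter, the
symmetry type, the rescaled unknown, the site, the Fourier mode and the time. -/
structure Point where
  lam : ℝ
  sym : Bool
  x : ℕ × ℕ → ℝ
  i : ℕ
  j : ℕ
  t : ℝ

namespace Point

/-- The decay rate of the breather. -/
noncomputable def rate (p : Point) : ℝ := p.lam ^ 3

/-- The exponential weight at the site of `p`. -/
noncomputable def weight (p : Point) : ℝ := weightBase p.rate ^ p.i

/-- The next site. -/
def next (p : Point) : Point := { p with i := p.i + 1 }

/-- The previous site. -/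
def prev (p : Point) : Point := { p with i := left p.sym p.i }

/-- Replace the unknown. -/
def withX (p : Point) (x : ℕ × ℕ → ℝ) : Point := { p with x := x }

/-- Replace the site. -/
def withI (p : Point) (i : ℕ) : Point := { p with i := i }

/-- Replace the mode. -/
def withJ (p : Point) (j : ℕ) : Point := { p with j := j }

/-- Replace the time. -/
def withT (p : Point) (t : ℝ) : Point := { p with t := t }

/-- The range of parameters under consideration. -/
structure Adm (p : Point) : Prop where
  pos : 0 < p.lam
  le_one : p.lam ≤ 1
  abs_le : ∀ q, |p.x q| ≤ 1

theorem Adm.next {p : Point} (hp : p.Adm) : p.next.Adm := ⟨hp.1, hp.2, hp.3⟩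
theorem Adm.prev {p : Point} (hp : p.Adm) : p.prev.Adm := ⟨hp.1, hp.2, hp.3⟩
theorem Adm.withI {p : Point} (hp : p.Adm) (i : ℕ) : (p.withI i).Adm := ⟨hp.1, hp.2, hp.3⟩
theorem Adm.withJ {p : Point} (hp : p.Adm) (j : ℕ) : (p.withJ j).Adm := ⟨hp.1, hp.2, hp.3⟩
theorem Adm.withT {p : Point} (hp : p.Adm) (t : ℝ) : (p.withT t).Adm := ⟨hp.1, hp.2, hp.3⟩
theorem Adm.withX {p : Point} (hp : p.Adm) {x : ℕ × ℕ → ℝ} (hx : ∀ q, |x q| ≤ 1) :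
    (p.withX x).Adm := ⟨hp.1, hp.2, hx⟩

section
variable {p : Point} (hp : p.Adm)
include hp

theorem Adm.rate_pos : 0 < p.rate := pow_pos hp.pos 3
theorem Adm.rate_le_one : p.rate ≤ 1 := pow_le_one₀ hp.pos.le hp.le_one
omit hp in
theorem weight_pos (p : Point) : 0 < p.weight := pow_pos (weightBase_pos _) _
theorem Adm.weight_le_one : p.weight ≤ 1 :=
  pow_le_one₀ (weightBase_pos _).le (weightBase_lt_one hp.rate_pos).le
theorem Adm.weight_next_le : p.next.weight ≤ p.weight :=
  pow_le_pow_of_le_one (weightBase_pos _).le (weightBase_lt_one hp.rate_pos).le (Nat.le_succ _)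

theorem Adm.weightBase_mul_weight_prev_le : weightBase p.rate * p.prev.weight ≤ p.weight := by
  have h0 := (weightBase_pos p.rate).le
  have h1 := (weightBase_lt_one hp.rate_pos).le
  rw [weight, weight, show p.prev.rate = p.rate from rfl, ← pow_succ']
  refine pow_le_pow_of_le_one h0 h1 ?_
  simp only [Point.prev]
  cases p.i with
  | zero => exact Nat.zero_le _
  | succ n => exact le_rfl

theorem Adm.weight_prev_le : p.prev.weight ≤ 2 * p.weight := by
  have h2 := hp.weightBase_mul_weight_prev_le
  have h3 : 1 / 2 ≤ weightBase p.rate := by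
    have := add_one_le_exp (-(p.rate / 2))
    have := hp.rate_le_one
    unfold weightBase
    linarith
  nlinarith [p.prev.weight_pos]
end
end Point

open Point

/-- `F` is of order `λ ^ k` in size and `λ ^ l` in its Lipschitz dependence on the unknown, with
spatial decay given by the `n`-th power of the weight. -/
def Est (F : Point → ℝ) (n k l : ℕ) : Prop :=
  ∃ C, 0 ≤ C ∧ ∀ p : Point, p.Adm → |F p| ≤ C * p.lam ^ k * p.weight ^ n ∧
    ∀ x d, (∀ q, |x q| ≤ 1) → (∀ q, |p.x q - x q| ≤ d) →
      |F p - F (p.withX x)| ≤ C * p.lam ^ l * p.weight ^ n * d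

namespace Est
variable {F G : Point → ℝ} {n k l n' k' l' : ℕ}

theorem congr (hF : Est F n k l) (h : ∀ p : Point, p.Adm → G p = F p) : Est G n k l := by
  obtain ⟨C, hC, hF⟩ := hF
  refine ⟨C, hC, fun p hp => ⟨by rw [h p hp]; exact (hF p hp).1, fun x d hx hd => ?_⟩⟩
  rw [h p hp, h _ (hp.withX hx)]
  exact (hF p hp).2 x d hx hd

theorem mono (hF : Est F n k l) (hn : n' ≤ n) (hk : k' ≤ k) (hl : l' ≤ l) : Est F n' k' l' := by
  obtain ⟨C, hC, hF⟩ := hF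
  refine ⟨C, hC, fun p hp => ?_⟩
  have h0 := hp.pos.le
  have h1 := p.weight_pos.le
  have hw := pow_le_pow_of_le_one h1 hp.weight_le_one hn
  have hk := pow_le_pow_of_le_one h0 hp.le_one hk
  have hl := pow_le_pow_of_le_one h0 hp.le_one hl
  refine ⟨(hF p hp).1.trans (by gcongr), fun x d hx hd => ?_⟩
  have hd0 := (abs_nonneg _).trans (hd (0, 0))
  exact ((hF p hp).2 x d hx hd).trans (by gcongr)

theorem add (hF : Est F n k l) (hG : Est G n k l) : Est (fun p => F p + G p) n k l := by
  obtain ⟨C, hC, hF⟩ := hF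
  obtain ⟨C', hC', hG⟩ := hG
  refine ⟨C + C', by positivity, fun p hp => ⟨?_, fun x d hx hd => ?_⟩⟩
  · refine (abs_add_le _ _).trans ((add_le_add (hF p hp).1 (hG p hp).1).trans_eq (by ring))
  · rw [add_sub_add_comm]
    refine (abs_add_le _ _).trans
      ((add_le_add ((hF p hp).2 x d hx hd) ((hG p hp).2 x d hx hd)).trans_eq (by ring))

theorem const_mul (a : ℝ) (hF : Est F n k l) : Est (fun p => a * F p) n k l := by
  obtain ⟨C, hC, hF⟩ := hF
  refine ⟨|a| * C, by positivity, fun p hp => ⟨?_, fun x d hx hd => ?_⟩⟩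
  · rw [abs_mul, mul_assoc, mul_assoc]
    exact mul_le_mul_of_nonneg_left (by simpa [mul_assoc] using (hF p hp).1) (abs_nonneg a)
  · rw [← mul_sub, abs_mul, mul_assoc, mul_assoc, mul_assoc]
    exact mul_le_mul_of_nonneg_left (by simpa [mul_assoc] using (hF p hp).2 x d hx hd)
      (abs_nonneg a)

theorem sub (hF : Est F n k l) (hG : Est G n k l) : Est (fun p => F p - G p) n k l :=
  (hF.add (hG.const_mul (-1))).congr fun p _ => by ring

theorem mul (hF : Est F n k l) (hG : Est G n' k' l') :
    Est (fun p => F p * G p) (n + n') (k + k') (min (k + l') (l + k')) := by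
  obtain ⟨C, hC, hF⟩ := hF
  obtain ⟨C', hC', hG⟩ := hG
  refine ⟨2 * C * C', by positivity, fun p hp => ?_⟩
  have h0 := hp.pos
  have h1 := p.weight_pos
  refine ⟨?_, fun x d hx hd => ?_⟩
  · rw [abs_mul]
    calc _ ≤ (C * p.lam ^ k * p.weight ^ n) * (C' * p.lam ^ k' * p.weight ^ n') :=
          mul_le_mul (hF p hp).1 (hG p hp).1 (abs_nonneg _) (by positivity)
      _ = 1 * (C * C' * p.lam ^ (k + k') * p.weight ^ (n + n')) := by ring
      _ ≤ 2 * (C * C' * p.lam ^ (k + k') * p.weight ^ (n + n')) := by gcongr; norm_num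
      _ = _ := by ring
  · have hd0 := (abs_nonneg _).trans (hd (0, 0))
    have e1 := pow_le_pow_of_le_one h0.le hp.le_one (min_le_left (k + l') (l + k'))
    have e2 := pow_le_pow_of_le_one h0.le hp.le_one (min_le_right (k + l') (l + k'))
    calc |F p * G p - F (p.withX x) * G (p.withX x)|
        = |F (p.withX x) * (G p - G (p.withX x)) + (F p - F (p.withX x)) * G p| := by
          congr 1; ring
      _ ≤ |F (p.withX x)| * |G p - G (p.withX x)| + |F p - F (p.withX x)| * |G p| := by
          rw [← abs_mul, ← abs_mul]; exact abs_add_le _ _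
      _ ≤ (C * p.lam ^ k * p.weight ^ n) * (C' * p.lam ^ l' * p.weight ^ n' * d) +
          (C * p.lam ^ l * p.weight ^ n * d) * (C' * p.lam ^ k' * p.weight ^ n') :=
          add_le_add (mul_le_mul (hF _ (hp.withX hx)).1 ((hG p hp).2 x d hx hd) (abs_nonneg _)
            (by positivity)) (mul_le_mul ((hF p hp).2 x d hx hd) (hG p hp).1 (abs_nonneg _)
            (by positivity))
      _ = C * C' * p.lam ^ (k + l') * p.weight ^ (n + n') * d +
          C * C' * p.lam ^ (l + k') * p.weight ^ (n + n') * d := by ring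
      _ ≤ C * C' * p.lam ^ min (k + l') (l + k') * p.weight ^ (n + n') * d +
          C * C' * p.lam ^ min (k + l') (l + k') * p.weight ^ (n + n') * d := by gcongr
      _ = _ := by ring

theorem of_indep (l : ℕ) (h : ∀ p x, F (Point.withX p x) = F p) {C : ℝ} (hC : 0 ≤ C)
    (hF : ∀ p : Point, p.Adm → |F p| ≤ C * p.lam ^ k * p.weight ^ n) : Est F n k l := by
  refine ⟨C, hC, fun p hp => ⟨hF p hp, fun x d _ hd => ?_⟩⟩
  have hd0 := (abs_nonneg _).trans (hd (0, 0))
  have := hp.pos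
  have := p.weight_pos
  rw [h, sub_self, abs_zero]
  positivity

theorem comp_next (hF : Est F n k l) : Est (fun p => F p.next) n k l := by
  obtain ⟨C, hC, hF⟩ := hF
  refine ⟨C, hC, fun p hp => ?_⟩
  have h0 := hp.pos.le
  have hw : p.next.weight ^ n ≤ p.weight ^ n :=
    pow_le_pow_left₀ p.next.weight_pos.le hp.weight_next_le n
  refine ⟨(hF _ hp.next).1.trans ?_, fun x d hx hd => ((hF _ hp.next).2 x d hx hd).trans ?_⟩
  · show C * p.lam ^ k * _ ≤ _
    gcongr
  · have hd0 := (abs_nonneg _).trans (hd (0, 0))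
    show C * p.lam ^ l * _ * _ ≤ _
    gcongr

theorem comp_prev (hF : Est F n k l) : Est (fun p => F p.prev) n k l := by
  obtain ⟨C, hC, hF⟩ := hF
  refine ⟨C * 2 ^ n, by positivity, fun p hp => ?_⟩
  have h0 := hp.pos.le
  have hw : p.prev.weight ^ n ≤ 2 ^ n * p.weight ^ n := by
    rw [← mul_pow]
    exact pow_le_pow_left₀ p.prev.weight_pos.le hp.weight_prev_le n
  refine ⟨(hF _ hp.prev).1.trans ?_, fun x d hx hd => ((hF _ hp.prev).2 x d hx hd).trans ?_⟩
  · show C * p.lam ^ k * _ ≤ _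
    calc _ ≤ C * p.lam ^ k * (2 ^ n * p.weight ^ n) := by gcongr
      _ = _ := by ring
  · have hd0 := (abs_nonneg _).trans (hd (0, 0))
    show C * p.lam ^ l * _ * _ ≤ _
    calc _ ≤ C * p.lam ^ l * (2 ^ n * p.weight ^ n) * d := by gcongr
      _ = _ := by ring

theorem cosCoeff (hF : Est F n k l)
    (hc : ∀ p : Point, p.Adm → Continuous fun t => F (p.withT t)) :
    Est (fun p => KleinGordon.cosCoeff (fun t => F (p.withT t)) p.j) n k l := by
  obtain ⟨C, hC, hF⟩ := hF
  refine ⟨2 * C, by positivity, fun p hp => ⟨?_, fun x d hx hd => ?_⟩⟩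
  · refine (abs_cosCoeff_le (M := C * p.lam ^ k * p.weight ^ n)
      (fun t => (hF _ (hp.withT t)).1) _).trans_eq ?_
    ring
  · have h := cosCoeff_sub (hc p hp) (hc _ (hp.withX hx)) p.j
    show |KleinGordon.cosCoeff (fun t => F (p.withT t)) p.j -
      KleinGordon.cosCoeff (fun t => F ((p.withX x).withT t)) p.j| ≤ _
    rw [← h]
    refine (abs_cosCoeff_le (M := C * p.lam ^ l * p.weight ^ n * d)
      (fun t => (hF _ (hp.withT t)).2 x d hx hd) _).trans_eq ?_
    ring

theorem green {k l : ℕ} (hF : Est F 1 (k + 6) (l + 6)) :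
    Est (fun p => KleinGordon.green p.sym p.rate (fun m => F (p.withI m)) p.i) 1 k l := by
  obtain ⟨C, hC, hF⟩ := hF
  refine ⟨264 * C, by positivity, fun p hp => ?_⟩
  have h0 := hp.pos
  have hb : ∀ y : ℕ × ℕ → ℝ, (∀ q, |y q| ≤ 1) → ∀ m, |F ((p.withX y).withI m)| ≤
      C * p.lam ^ (k + 6) * weightBase p.rate ^ m := fun y hy m => by
    refine (hF _ ((hp.withX hy).withI m)).1.trans_eq ?_
    rw [pow_one]
    rfl
  refine ⟨?_, fun x d hx hd => ?_⟩
  · refine (abs_green_le hp.rate_pos hp.rate_le_one (hb p.x hp.abs_le) p.sym p.i).trans_eq ?_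
    rw [rate, pow_one, pow_add]
    simp only [weight, rate]
    field_simp
  · show |KleinGordon.green p.sym p.rate (fun m => F (p.withI m)) p.i -
      KleinGordon.green p.sym p.rate (fun m => F ((p.withX x).withI m)) p.i| ≤ _
    rw [green_sub _ hp.rate_pos (f := fun m => F (p.withI m)) (hb p.x hp.abs_le) (hb x hx)]
    have hb' : ∀ m, |F (p.withI m) - F ((p.withX x).withI m)| ≤
        C * p.lam ^ (l + 6) * d * weightBase p.rate ^ m := fun m => by
      refine ((hF _ (hp.withI m)).2 x d hx hd).trans_eq ?_
      show C * p.lam ^ (l + 6) * (weightBase p.rate ^ m) ^ 1 * d = _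
      ring
    refine (abs_green_le hp.rate_pos hp.rate_le_one hb' p.sym p.i).trans_eq ?_
    rw [rate, pow_one, pow_add]
    simp only [weight, rate]
    field_simp

theorem next_sub (hF : Est (fun p => F p.next + F p.prev - 2 * F p) 1 (k + 3) (l + 3)) :
    Est (fun p => F p.next - F p) 0 k l := by
  obtain ⟨C, hC, hF⟩ := hF
  refine ⟨3 * C, by positivity, fun p hp => ?_⟩
  have h0 := hp.pos
  refine ⟨?_, fun x d hx hd => ?_⟩
  · have h := abs_succ_sub_le hp.rate_pos hp.rate_le_one (c := p.sym)
      (v := fun m => F (p.withI m)) (M := C * p.lam ^ (k + 3))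
      (fun m => (hF _ (hp.withI m)).1.trans_eq (by rw [pow_one]; rfl)) p.i
    refine h.trans_eq ?_
    rw [rate, pow_add]
    field_simp
  · have h := abs_succ_sub_le hp.rate_pos hp.rate_le_one (c := p.sym)
      (v := fun m => F (p.withI m) - F ((p.withX x).withI m)) (M := C * p.lam ^ (l + 3) * d)
      (fun m => by
        refine le_trans (le_of_eq ?_) (((hF _ (hp.withI m)).2 x d hx hd).trans_eq ?_)
        · congr 1
          show F (p.withI (m + 1)) - F ((p.withX x).withI (m + 1)) +
            (F (p.withI (left p.sym m)) - F ((p.withX x).withI (left p.sym m))) -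
            2 * (F (p.withI m) - F ((p.withX x).withI m)) =
            F (p.withI (m + 1)) + F (p.withI (left p.sym m)) - 2 * F (p.withI m) -
            (F ((p.withX x).withI (m + 1)) + F ((p.withX x).withI (left p.sym m)) -
            2 * F ((p.withX x).withI m))
          ring
        · show C * p.lam ^ (l + 3) * (weightBase p.rate ^ m) ^ 1 * d = _
          ring) p.i
    refine le_trans (le_of_eq ?_) (h.trans_eq ?_)
    · congr 1
      show F (p.withI (p.i + 1)) - F (p.withI p.i) - (F ((p.withX x).withI (p.i + 1)) -
        F ((p.withX x).withI p.i)) = F (p.withI (p.i + 1)) - F ((p.withX x).withI (p.i + 1)) -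
        (F (p.withI p.i) - F ((p.withX x).withI p.i))
      ring
    · rw [rate, pow_add]
      field_simp

theorem prev_sub (hF : Est (fun p => F p.next - F p) 0 k l) :
    Est (fun p => F p.prev - F p) 0 k l := by
  obtain ⟨C, hC, hF⟩ := hF
  refine ⟨C, hC, fun p hp => ?_⟩
  have h0 := hp.pos
  obtain ⟨lam, c, x, i, j, t⟩ := p
  cases i with
  | zero =>
    cases c with
    | false => exact hF _ hp
    | true =>
      refine ⟨?_, fun x d hx hd => ?_⟩
      · show |F _ - F _| ≤ _
        simp only [Point.prev, left, if_true, sub_self, abs_zero]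
        positivity
      · have hd0 := (abs_nonneg _).trans (hd (0, 0))
        show |F _ - F _ - (F _ - F _)| ≤ _
        simp only [Point.prev, left, if_true, Point.withX, sub_self, abs_zero]
        positivity
  | succ i =>
    have h := hF _ (hp.withI i)
    refine ⟨?_, fun x d hx hd => ?_⟩
    · rw [abs_sub_comm]
      exact h.1
    · rw [abs_sub_comm]
      refine le_trans (le_of_eq ?_) (((h.2 x d hx hd)).trans_eq ?_)
      · congr 1
        simp only [Point.next, Point.prev, Point.withX, Point.withI, left]
        ring
      · simp [Point.withI]

end Est
end KleinGordon

namespace KleinGordon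

open Real

/-- The normalized on-site nonlinearity: coupling constant, Taylor coefficients and remainder of
order four. -/
structure Model where
  om : ℝ
  α : ℝ
  β : ℝ
  K : ℝ
  T : ℝ → ℝ
  om_gt : 4 / 3 < om
  soft : β - 5 / 3 * α ^ 2 < 0
  K_nonneg : 0 ≤ K
  T_zero : T 0 = 0
  T_lip : ∀ z z' R, |z| ≤ R → |z'| ≤ R → |T z - T z'| ≤ K * R ^ 3 * |z - z'|

namespace Point

/-- The phase of the site of `p`. -/
noncomputable def theta (p : Point) : ℝ := phase p.sym p.rate p.i

/-- The detuning of the frequency from the band edge. -/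
noncomputable def excess (p : Point) : ℝ := 2 * cosh p.rate - 2

/-- The squared soliton profile. -/
noncomputable def prof (p : Point) : ℝ := profileSq p.rate p.theta

/-- The reciprocal of one plus the squared soliton profile. -/
noncomputable def recip (p : Point) : ℝ := 1 / (1 + p.prof)

/-- The rescaled source term of the equation for the amplitude correction. -/
noncomputable def force (p : Point) : ℝ := p.lam ^ 10 * p.weight * p.x (p.i, 1)

/-- The correction to the soliton amplitude. -/
noncomputable def corr (p : Point) : ℝ :=
  green p.sym p.rate (fun m => force (p.withI m)) p.i

/-- The remainder in the non-resonant modes. -/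
noncomputable def rem (p : Point) : ℝ :=
  if p.j = 1 then 0 else p.lam ^ 8 * p.weight * p.x (p.i, p.j) / (1 + (p.j : ℝ) ^ 2)

/-- The remainder as a function of time. -/
noncomputable def remSeries (p : Point) : ℝ := cosSeries (fun j => rem (p.withJ j)) p.t

theorem prof_nonneg (p : Point) : 0 ≤ p.prof := sq_nonneg _

theorem recip_mul (p : Point) : p.recip * (1 + p.prof) = 1 :=
  one_div_mul_cancel (by linarith [p.prof_nonneg])

theorem linPot_eq_recip (p : Point) : linPot p.rate p.theta =
    (2 + p.excess) * (1 - (3 * p.prof + p.prof ^ 2) * p.recip ^ 2) := by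
  have h := p.recip_mul
  have h1 : (1 + p.prof) ≠ 0 := by linarith [p.prof_nonneg]
  have h2 : linPot p.rate p.theta = (2 + p.excess) * (1 - p.prof) * p.recip ^ 2 := by
    rw [linPot, recip, excess, prof, one_div, inv_pow]
    ring
  rw [h2]
  linear_combination (2 + p.excess) * (p.recip * (1 + p.prof) + 1) * h

end Point

open Point

theorem est_const (a : ℝ) (l : ℕ) : Est (fun _ => a) 0 0 l :=
  Est.of_indep l (fun _ _ => rfl) (abs_nonneg a) fun _ _ => by simp

theorem est_cos (a : ℝ) (l : ℕ) : Est (fun p => cos (a * p.t)) 0 0 l :=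
  Est.of_indep l (fun _ _ => rfl) zero_le_one fun _ _ => by simpa using abs_cos_le_one _

theorem est_excess (l : ℕ) : Est excess 0 6 l := by
  refine Est.of_indep l (fun _ _ => rfl) (C := 4) (by norm_num) fun p hp => ?_
  have h := cosh_sub_one_le hp.rate_pos.le hp.rate_le_one
  have h2 := one_le_cosh p.rate
  rw [excess, abs_of_nonneg (by linarith)]
  calc _ ≤ 4 * p.rate ^ 2 := by linarith
    _ = _ := by rw [rate]; ring

theorem Point.Adm.prof_le {p : Point} (hp : p.Adm) : p.prof ≤ 4 * p.lam ^ 6 := by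
  have h := sinh_le_two_mul hp.rate_pos.le hp.rate_le_one
  have h0 : 0 ≤ sinh p.rate := sinh_nonneg_iff.mpr hp.rate_pos.le
  calc p.prof ≤ (2 * p.rate) ^ 2 := by
        refine pow_le_pow_left₀ (div_nonneg h0 (cosh_pos _).le) ?_ 2
        exact (div_le_self h0 (one_le_cosh _)).trans h
    _ = _ := by rw [rate]; ring

theorem est_prof (l : ℕ) : Est prof 0 6 l := by
  refine Est.of_indep l (fun _ _ => rfl) (C := 4) (by norm_num) fun p hp => ?_
  rw [abs_of_nonneg p.prof_nonneg]
  simpa using hp.prof_le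

theorem est_recip (l : ℕ) : Est recip 0 0 l := by
  refine Est.of_indep l (fun _ _ => rfl) (C := 1) (by norm_num) fun p hp => ?_
  have := p.prof_nonneg
  rw [recip, abs_of_nonneg (by positivity), div_le_iff₀ (by positivity)]
  simpa using this

theorem est_force : Est force 1 10 10 := by
  refine ⟨1, zero_le_one, fun p hp => ?_⟩
  have h0 := hp.pos
  have h1 := p.weight_pos
  refine ⟨?_, fun x d hx hd => ?_⟩
  · rw [force, abs_mul, abs_of_pos (by positivity), one_mul, pow_one]
    exact mul_le_of_le_one_right (by positivity) (hp.abs_le _)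
  · show |p.lam ^ 10 * p.weight * p.x (p.i, 1) - p.lam ^ 10 * p.weight * x (p.i, 1)| ≤ _
    rw [← mul_sub, abs_mul, abs_of_pos (by positivity), one_mul, pow_one]
    gcongr
    exact hd _

theorem est_corr : Est corr 1 4 4 := Est.green est_force

theorem corr_recurrence {p : Point} (hp : p.Adm) :
    p.next.corr + p.prev.corr - linPot p.rate p.theta * p.corr = p.force := by
  obtain ⟨C, -, h⟩ := est_force
  exact green_recurrence hp.rate_pos (f := fun m => force (p.withI m)) (M := C * p.lam ^ 10)
    (fun m => (h _ (hp.withI m)).1.trans_eq (by rw [pow_one]; rfl)) p.sym p.i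

theorem abs_rem_le {p : Point} (hp : p.Adm) (j : ℕ) :
    |rem (p.withJ j)| ≤ p.lam ^ 8 * p.weight / (1 + (j : ℝ) ^ 2) := by
  have h0 := hp.pos
  have h1 := p.weight_pos
  unfold rem
  split_ifs
  · rw [abs_zero]
    positivity
  · show |p.lam ^ 8 * p.weight * p.x (p.i, j) / (1 + (j : ℝ) ^ 2)| ≤ _
    rw [abs_div, abs_mul, abs_of_pos (by positivity : 0 < p.lam ^ 8 * p.weight),
      abs_of_pos (by positivity : 0 < 1 + (j : ℝ) ^ 2)]
    refine div_le_div_of_nonneg_right ?_ (by positivity)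
    exact mul_le_of_le_one_right (by positivity) (hp.abs_le _)

theorem abs_rem_sub_le {p : Point} (hp : p.Adm) {x : ℕ × ℕ → ℝ} {d : ℝ}
    (hd : ∀ q, |p.x q - x q| ≤ d) (j : ℕ) :
    |rem (p.withJ j) - rem ((p.withX x).withJ j)| ≤
      p.lam ^ 8 * p.weight * d / (1 + (j : ℝ) ^ 2) := by
  have h0 := hp.pos
  have h1 := p.weight_pos
  have hd0 := (abs_nonneg _).trans (hd (0, 0))
  by_cases hj : j = 1
  · have h2 : ∀ p : Point, rem (p.withJ j) = 0 := fun p => if_pos hj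
    rw [h2, h2, sub_zero, abs_zero]
    positivity
  · have h2 : ∀ p : Point, rem (p.withJ j) =
        p.lam ^ 8 * p.weight * p.x (p.i, j) / (1 + (j : ℝ) ^ 2) := fun p => if_neg hj
    rw [h2, h2]
    show |p.lam ^ 8 * p.weight * p.x (p.i, j) / (1 + (j : ℝ) ^ 2) -
      p.lam ^ 8 * p.weight * x (p.i, j) / (1 + (j : ℝ) ^ 2)| ≤ _
    rw [← sub_div, ← mul_sub, abs_div, abs_mul,
      abs_of_pos (by positivity : 0 < p.lam ^ 8 * p.weight),
      abs_of_pos (by positivity : 0 < 1 + (j : ℝ) ^ 2)]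
    gcongr
    exact hd _

theorem est_remSeries : Est remSeries 1 8 8 := by
  refine ⟨∑' j : ℕ, 1 / (1 + (j : ℝ) ^ 2), tsum_nonneg fun j => by positivity,
    fun p hp => ⟨?_, fun x d hx hd => ?_⟩⟩
  · refine (abs_cosSeries_le (abs_rem_le hp) _).trans_eq ?_
    ring
  · show |cosSeries (fun j => rem (p.withJ j)) p.t -
      cosSeries (fun j => rem ((p.withX x).withJ j)) p.t| ≤ _
    rw [← cosSeries_sub (abs_rem_le hp) (abs_rem_le (hp.withX hx))]
    refine (abs_cosSeries_le (abs_rem_sub_le hp hd) _).trans_eq ?_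
    ring

namespace Model
variable (P : Model)

/-- The (positive) cubic coefficient of the amplitude equation. -/
noncomputable def gam : ℝ := -(P.om * (P.β - 5 / 3 * P.α ^ 2)) / 8

theorem om_pos : 0 < P.om := by linarith [P.om_gt]

theorem gam_pos : 0 < P.gam := by
  have := mul_neg_of_pos_of_neg P.om_pos P.soft
  unfold gam
  linarith

/-- The amplitude of the Ablowitz-Ladik soliton. -/
noncomputable def bright (p : Point) : ℝ :=
  √(2 / P.gam) * (sinh p.rate * (1 / cosh p.theta))

theorem gam_mul_bright_sq (p : Point) : P.gam * P.bright p ^ 2 = 2 * p.prof := by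
  have h := P.gam_pos
  rw [bright, mul_pow, sq_sqrt (by positivity), prof, profileSq]
  field_simp

theorem bright_add (p : Point) :
    P.bright p.next + P.bright p.prev = (2 + p.excess) * p.recip * P.bright p := by
  have h := inv_cosh_add p.rate p.theta
  have h1 : cosh p.next.theta = cosh (p.theta + p.rate) := congrArg cosh (phase_succ _ _ _)
  have h2 : cosh p.prev.theta = cosh (p.theta - p.rate) := phase_left cosh_neg _ _ _
  rw [bright, bright, bright, h1, h2]
  show √(2 / P.gam) * (sinh p.rate * _) + √(2 / P.gam) * (sinh p.rate * _) = _
  rw [← mul_add, ← mul_add, h, recip, excess, prof]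
  ring

theorem est_bright (l : ℕ) : Est P.bright 1 3 l := by
  refine Est.of_indep l (fun _ _ => rfl) (C := 4 * √(2 / P.gam)) (by positivity) fun p hp => ?_
  have h := sinh_le_two_mul hp.rate_pos.le hp.rate_le_one
  have h0 : 0 ≤ sinh p.rate := sinh_nonneg_iff.mpr hp.rate_pos.le
  have h2 : 1 / cosh p.theta ≤ 2 * p.weight := by
    refine inv_cosh_le.trans ?_
    have h3 : exp (-p.theta) ≤ p.weight ^ 2 := exp_neg_phase_le p.sym hp.rate_pos.le p.i
    nlinarith [hp.weight_le_one, p.weight_pos]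
  have h4 := cosh_pos p.theta
  have h5 := hp.rate_pos
  rw [bright, abs_of_nonneg (by positivity)]
  calc _ ≤ √(2 / P.gam) * (2 * p.rate * (2 * p.weight)) := by gcongr
    _ = _ := by rw [rate]; ring

/-- The amplitude of the fundamental mode. -/
noncomputable def amp (p : Point) : ℝ := P.bright p + p.corr

theorem est_amp : Est P.amp 1 3 4 :=
  (P.est_bright 4).add (est_corr.mono le_rfl (by norm_num) le_rfl)

/-- Coefficients of the quadratic response. -/
noncomputable def quad (j : ℕ) : ℝ :=
  (if j = 0 then -P.α / 4 else 0) + if j = 2 then P.α / 12 else 0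

theorem est_quad (l : ℕ) : Est (fun p => P.quad p.j) 0 0 l := by
  refine Est.of_indep l (fun _ _ => rfl) (abs_nonneg P.α) fun p hp => ?_
  rw [pow_zero, pow_zero, mul_one, mul_one, quad]
  split_ifs with h0 h2 h2
  · omega
  · rw [add_zero, abs_div, abs_neg, abs_of_pos (by norm_num : (0 : ℝ) < 4)]
    linarith [abs_nonneg P.α]
  · rw [zero_add, abs_div, abs_of_pos (by norm_num : (0 : ℝ) < 12)]
    linarith [abs_nonneg P.α]
  · simp

/-- The Fourier coefficients of the breather. -/
noncomputable def coef (p : Point) : ℝ :=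
  (if p.j = 1 then P.amp p else 0) + P.quad p.j * P.amp p ^ 2 + p.rem

/-- The breather. -/
noncomputable def sol (p : Point) : ℝ := cosSeries (fun j => P.coef (p.withJ j)) p.t

end Model

theorem abs_ite_eq_le (n : ℕ) (a : ℝ) (j : ℕ) :
    |if j = n then a else 0| ≤ |a| * (1 + (n : ℝ) ^ 2) / (1 + (j : ℝ) ^ 2) := by
  split_ifs with h
  · rw [h, mul_div_cancel_right₀ _ (by positivity)]
  · rw [abs_zero]
    positivity

theorem cosSeries_ite_eq (n : ℕ) (a t : ℝ) :
    cosSeries (fun j => if j = n then a else 0) t = a * cos (n * t) := by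
  simp [cosSeries, ite_mul]

theorem abs_add_le_div {a b M M' D : ℝ} (h : |a| ≤ M / D) (h' : |b| ≤ M' / D) :
    |a + b| ≤ (M + M') / D := by
  rw [add_div]
  exact (abs_add_le _ _).trans (add_le_add h h')

namespace Model
variable (P : Model)

theorem coef_withJ (p : Point) : (fun j => P.coef (p.withJ j)) = fun j =>
    (if j = 1 then P.amp p else 0) + ((if j = 0 then -P.α / 4 * P.amp p ^ 2 else 0) +
      if j = 2 then P.α / 12 * P.amp p ^ 2 else 0) + rem (p.withJ j) := by
  ext j
  show (if j = 1 then P.amp p else 0) + P.quad j * P.amp p ^ 2 + _ = _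
  rw [quad, add_mul, ite_mul, ite_mul, zero_mul]

theorem exists_abs_coef_le {p : Point} (hp : p.Adm) :
    ∃ M, ∀ j, |P.coef (p.withJ j)| ≤ M / (1 + (j : ℝ) ^ 2) := by
  have h : ∀ j, _ := fun j => abs_add_le_div (abs_add_le_div (abs_ite_eq_le 1 (P.amp p) j)
    (abs_add_le_div (abs_ite_eq_le 0 (-P.α / 4 * P.amp p ^ 2) j)
    (abs_ite_eq_le 2 (P.α / 12 * P.amp p ^ 2) j))) (abs_rem_le hp j)
  exact ⟨_, fun j => (congrArg abs (congrFun (P.coef_withJ p) j)).trans_le (h j)⟩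

theorem sol_eq {p : Point} (hp : p.Adm) : P.sol p =
    P.amp p * cos (1 * p.t) + (-P.α / 4 + P.α / 12 * cos (2 * p.t)) * P.amp p ^ 2 +
      p.remSeries := by
  rw [sol, coef_withJ, cosSeries_add (fun j => abs_add_le_div (abs_ite_eq_le 1 _ j)
    (abs_add_le_div (abs_ite_eq_le 0 _ j) (abs_ite_eq_le 2 _ j))) (abs_rem_le hp),
    cosSeries_add (fun j => abs_ite_eq_le 1 _ j)
    (fun j => abs_add_le_div (abs_ite_eq_le 0 _ j) (abs_ite_eq_le 2 _ j)),
    cosSeries_add (fun j => abs_ite_eq_le 0 _ j) (fun j => abs_ite_eq_le 2 _ j),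
    cosSeries_ite_eq, cosSeries_ite_eq, cosSeries_ite_eq, remSeries]
  push_cast
  rw [zero_mul, cos_zero]
  ring

theorem continuous_sol {p : Point} (hp : p.Adm) : Continuous fun t => P.sol (p.withT t) := by
  obtain ⟨M, hM⟩ := P.exists_abs_coef_le hp
  exact continuous_cosSeries hM

theorem est_amp_sq : Est (fun p => P.amp p ^ 2) 1 6 7 :=
  ((P.est_amp.mul P.est_amp).mono (by norm_num) (by norm_num) (by norm_num)).congr
    fun p _ => sq _

theorem est_amp_cos : Est (fun p => P.amp p * cos (1 * p.t)) 1 3 4 :=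
  (P.est_amp.mul (est_cos 1 4)).mono le_rfl le_rfl (by norm_num)

theorem est_quad_part :
    Est (fun p => (-P.α / 4 + P.α / 12 * cos (2 * p.t)) * P.amp p ^ 2) 1 6 7 :=
  (((est_const _ 7).add ((est_cos 2 7).const_mul _)).mul P.est_amp_sq).mono (by norm_num)
    (by norm_num) (by norm_num)

theorem est_sol_sub : Est (fun p => P.sol p - P.amp p * cos (1 * p.t)) 1 6 7 :=
  (P.est_quad_part.add (est_remSeries.mono le_rfl (by norm_num) (by norm_num))).congr
    fun p hp => by rw [P.sol_eq hp]; ring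

theorem est_sol : Est P.sol 1 3 4 :=
  (P.est_amp_cos.add (P.est_sol_sub.mono le_rfl (by norm_num) (by norm_num))).congr
    fun p _ => by ring

theorem est_T_sol : Est (fun p => P.T (P.sol p)) 1 11 11 := by
  obtain ⟨C, hC, h⟩ := P.est_sol
  have hK := P.K_nonneg
  refine Est.mono (n := 4) (k := 12) (l := 13) ⟨P.K * C ^ 4, by positivity, fun p hp => ?_⟩
    (by norm_num) (by norm_num) (by norm_num)
  have h0 := hp.pos
  have h1 := p.weight_pos
  refine ⟨?_, fun x d hx hd => ?_⟩
  · have h2 := P.T_lip (P.sol p) 0 _ (h p hp).1 (by rw [abs_zero]; positivity)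
    rw [P.T_zero, sub_zero, sub_zero] at h2
    calc _ ≤ _ := h2
      _ ≤ P.K * (C * p.lam ^ 3 * p.weight ^ 1) ^ 3 * (C * p.lam ^ 3 * p.weight ^ 1) := by
        gcongr; exact (h p hp).1
      _ = _ := by ring
  · calc _ ≤ P.K * (C * p.lam ^ 3 * p.weight ^ 1) ^ 3 * |P.sol p - P.sol (p.withX x)| :=
          P.T_lip _ _ _ (h p hp).1 (h _ (hp.withX hx)).1
      _ ≤ P.K * (C * p.lam ^ 3 * p.weight ^ 1) ^ 3 * (C * p.lam ^ 4 * p.weight ^ 1 * d) := by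
        gcongr; exact (h p hp).2 x d hx hd
      _ = _ := by ring

theorem continuous_T : Continuous P.T := by
  rw [continuous_iff_continuousAt]
  intro z
  rw [ContinuousAt, tendsto_iff_dist_tendsto_zero]
  have h : Filter.Tendsto (fun y => P.K * (|z| + 1) ^ 3 * |y - z|) (nhds z) (nhds 0) := by
    have : Continuous fun y => P.K * (|z| + 1) ^ 3 * |y - z| := by fun_prop
    simpa using this.tendsto z
  refine squeeze_zero' (Filter.Eventually.of_forall fun _ => dist_nonneg) ?_ h
  filter_upwards [Metric.ball_mem_nhds z one_pos] with y hy
  have h2 : |y - z| < 1 := hy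
  have h3 := abs_sub_abs_le_abs_sub y z
  exact P.T_lip y z _ (by linarith) (by linarith)

end Model
end KleinGordon

namespace KleinGordon

open Real Point

theorem Est.pow_two {F : Point → ℝ} {n k l : ℕ} (hF : Est F n k l) :
    Est (fun p => F p ^ 2) (n + n) (k + k) (k + l) :=
  ((hF.mul hF).mono le_rfl le_rfl (by omega)).congr fun p _ => sq _

theorem Est.comp_withJ {F : Point → ℝ} {n k l : ℕ} (hF : Est F n k l) (j : ℕ) :
    Est (fun p => F (p.withJ j)) n k l := by
  obtain ⟨C, hC, hF⟩ := hF
  exact ⟨C, hC, fun p hp => hF _ (hp.withJ j)⟩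

theorem cosCoeff_trig (a b c d : ℝ) (j : ℕ) :
    cosCoeff (fun t => a + b * cos (1 * t) + c * cos (2 * t) + d * cos (3 * t)) j =
      a * (if 0 = j then 1 else 0) + b * (if 1 = j then 1 else 0) + c * (if 2 = j then 1 else 0) +
        d * (if 3 = j then 1 else 0) := by
  rw [cosCoeff_add (by fun_prop) (by fun_prop), cosCoeff_add (by fun_prop) (by fun_prop),
    cosCoeff_add (by fun_prop) (by fun_prop), cosCoeff_const_mul, cosCoeff_const_mul,
    cosCoeff_const_mul]
  have h0 := cosCoeff_const_mul a (fun t => cos ((0 : ℕ) * t)) j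
  have e1 := cosCoeff_cos 1 j
  have e2 := cosCoeff_cos 2 j
  have e3 := cosCoeff_cos 3 j
  simp only [Nat.cast_zero, zero_mul, cos_zero, mul_one] at h0
  have e0 := cosCoeff_cos 0 j
  simp only [Nat.cast_zero, zero_mul, cos_zero] at e0
  push_cast at e1 e2 e3
  rw [h0, e0, e1, e2, e3]

namespace Model
variable (P : Model)

/-- The nonlinear part of the force. -/
noncomputable def nonlin (z : ℝ) : ℝ := P.α / 2 * z ^ 2 + P.β / 6 * z ^ 3 + P.T z

theorem continuous_nonlin : Continuous P.nonlin := by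
  have := P.continuous_T
  unfold nonlin
  fun_prop

/-- The quadratic part of the force, to leading order. -/
noncomputable def lead (p : Point) : ℝ := P.α / 2 * (P.amp p * cos (1 * p.t)) ^ 2

/-- The part of the force that is quadratic and cubic in the amplitude. -/
noncomputable def main (p : Point) : ℝ :=
  P.lead p + P.α * (P.amp p * cos (1 * p.t)) *
    ((-P.α / 4 + P.α / 12 * cos (2 * p.t)) * P.amp p ^ 2) +
    P.β / 6 * (P.amp p * cos (1 * p.t)) ^ 3

theorem est_sol_mul (F : Point → ℝ) {k l : ℕ} (hF : Est F 1 k l) :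
    Est (fun p => (P.sol p - P.amp p * cos (1 * p.t)) * F p) 1 (6 + k) (min (6 + l) (7 + k)) :=
  (P.est_sol_sub.mul hF).mono (by norm_num) le_rfl le_rfl

theorem est_nonlin_sub_lead : Est (fun p => P.nonlin (P.sol p) - P.lead p) 1 9 10 := by
  have h1 := ((P.est_sol_mul _ (P.est_sol.add P.est_amp_cos)).const_mul (P.α / 2)).mono
    (le_refl 1) (by norm_num : 9 ≤ _) (by norm_num : 10 ≤ _)
  have h2 := ((P.est_sol.mul P.est_sol.pow_two).const_mul (P.β / 6)).mono
    (by norm_num : 1 ≤ _) (by norm_num : 9 ≤ _) (by norm_num : 10 ≤ _)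
  have h3 := P.est_T_sol.mono (le_refl 1) (by norm_num : 9 ≤ _) (by norm_num : 10 ≤ _)
  refine ((h1.add h2).add h3).congr fun p _ => ?_
  rw [nonlin, lead]
  ring

theorem est_nonlin_sub_main : Est (fun p => P.nonlin (P.sol p) - P.main p) 1 11 11 := by
  have h1 := ((P.est_amp_cos.mul est_remSeries).const_mul P.α).mono
    (by norm_num : 1 ≤ _) (by norm_num : 11 ≤ _) (by norm_num : 11 ≤ _)
  have h2 := (P.est_sol_sub.pow_two.const_mul (P.α / 2)).mono
    (by norm_num : 1 ≤ _) (by norm_num : 11 ≤ _) (by norm_num : 11 ≤ _)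
  have h3 := ((P.est_sol_mul _ ((P.est_sol.pow_two.add (P.est_sol.mul P.est_amp_cos)).add
    P.est_amp_cos.pow_two |>.mono (by norm_num : 1 ≤ _) le_rfl le_rfl)).const_mul (P.β / 6)).mono
    (le_refl 1) (by norm_num : 11 ≤ _) (by norm_num : 11 ≤ _)
  refine (((h1.add h2).add h3).add P.est_T_sol).congr fun p hp => ?_
  have h := P.sol_eq hp
  rw [nonlin, main, lead]
  rw [show p.remSeries = P.sol p - P.amp p * cos (1 * p.t) -
    (-P.α / 4 + P.α / 12 * cos (2 * p.t)) * P.amp p ^ 2 by rw [h]; ring]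
  ring

theorem cosCoeff_lead (p : Point) (j : ℕ) : cosCoeff (fun t => P.lead (p.withT t)) j =
    P.α / 4 * P.amp p ^ 2 * ((if 0 = j then 1 else 0) + if 2 = j then 1 else 0) := by
  have h : (fun t => P.lead (p.withT t)) = fun t => P.α / 4 * P.amp p ^ 2 + 0 * cos (1 * t) +
      P.α / 4 * P.amp p ^ 2 * cos (2 * t) + 0 * cos (3 * t) := by
    ext t
    show P.α / 2 * (P.amp p * cos (1 * t)) ^ 2 = _
    rw [one_mul, cos_two_mul]
    ring
  rw [h, cosCoeff_trig]
  ring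

theorem cosCoeff_main (p : Point) : cosCoeff (fun t => P.main (p.withT t)) 1 =
    (P.β - 5 / 3 * P.α ^ 2) / 8 * P.amp p ^ 3 := by
  have h : (fun t => P.main (p.withT t)) = fun t => P.α / 4 * P.amp p ^ 2 +
      (P.β - 5 / 3 * P.α ^ 2) / 8 * P.amp p ^ 3 * cos (1 * t) +
      P.α / 4 * P.amp p ^ 2 * cos (2 * t) +
      (P.α ^ 2 / 24 + P.β / 24) * P.amp p ^ 3 * cos (3 * t) := by
    ext t
    show P.α / 2 * (P.amp p * cos (1 * t)) ^ 2 + P.α * (P.amp p * cos (1 * t)) *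
      ((-P.α / 4 + P.α / 12 * cos (2 * t)) * P.amp p ^ 2) +
      P.β / 6 * (P.amp p * cos (1 * t)) ^ 3 = _
    rw [one_mul, cos_two_mul, cos_three_mul]
    ring
  rw [h, cosCoeff_trig]
  norm_num

theorem continuous_nonlin_sol {p : Point} (hp : p.Adm) :
    Continuous fun t => P.nonlin (P.sol (p.withT t)) :=
  P.continuous_nonlin.comp (P.continuous_sol hp)

theorem continuous_lead (p : Point) : Continuous fun t => P.lead (p.withT t) := by
  show Continuous fun t => P.α / 2 * (P.amp p * cos (1 * t)) ^ 2
  fun_prop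

theorem continuous_main (p : Point) : Continuous fun t => P.main (p.withT t) := by
  show Continuous fun t => P.α / 2 * (P.amp p * cos (1 * t)) ^ 2 + P.α * (P.amp p * cos (1 * t)) *
      ((-P.α / 4 + P.α / 12 * cos (2 * t)) * P.amp p ^ 2) +
      P.β / 6 * (P.amp p * cos (1 * t)) ^ 3
  fun_prop

theorem est_amp_lap : Est (fun p => P.amp p.next + P.amp p.prev - 2 * P.amp p) 1 9 10 := by
  have h1 := ((P.est_bright 10).mul (((est_excess 10).mul (est_recip 10)).sub
    (((est_prof 10).mul (est_recip 10)).const_mul 2))).mono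
    (by norm_num : 1 ≤ _) (by norm_num : 9 ≤ _) (by norm_num : 10 ≤ _)
  have h2 := (((est_excess 10).sub ((((est_const 2 10).add
    ((est_excess 10).mono le_rfl (Nat.zero_le _) le_rfl)).mul
    ((((est_prof 10).const_mul 3).add (((est_prof 10).pow_two).mono le_rfl (by norm_num)
      (by norm_num))).mul (est_recip 10).pow_two)).mono le_rfl le_rfl (by norm_num))).mul est_corr).mono
    (by norm_num : 1 ≤ _) (by norm_num : 9 ≤ _) (by norm_num : 10 ≤ _)
  have h3 := est_force.mono (le_refl 1) (by norm_num : 9 ≤ _) le_rfl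
  refine ((h1.add h2).add h3).congr fun p hp => ?_
  have e1 := P.bright_add p
  have e2 := corr_recurrence hp
  have e3 := p.linPot_eq_recip
  have e4 := p.recip_mul
  simp only [amp]
  rw [← e2, e3]
  linear_combination e1 + 2 * P.bright p * e4

end Model
end KleinGordon

namespace KleinGordon

open Real Point
namespace Model
variable (P : Model)

theorem est_lap_amp_sq :
    Est (fun p => P.amp p.next ^ 2 + P.amp p.prev ^ 2 - 2 * P.amp p ^ 2) 1 9 10 := by
  have h1 : Est (fun p => P.amp p.next - P.amp p) 0 6 7 := P.est_amp_lap.next_sub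
  have h2 := h1.prev_sub
  have h3 := ((P.est_amp.mul P.est_amp_lap).const_mul 2).mono
    (by norm_num : 1 ≤ _) (by norm_num : 9 ≤ _) (by norm_num : 10 ≤ _)
  have h4 := (h1.mul (P.est_amp.comp_next.sub P.est_amp)).mono
    (by norm_num : 1 ≤ _) (by norm_num : 9 ≤ _) (by norm_num : 10 ≤ _)
  have h5 := (h2.mul (P.est_amp.comp_prev.sub P.est_amp)).mono
    (by norm_num : 1 ≤ _) (by norm_num : 9 ≤ _) (by norm_num : 10 ≤ _)
  exact ((h3.add h4).add h5).congr fun p _ => by ring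

/-- The Fourier coefficients of the nonlinear force. -/
noncomputable def coefNonlin (p : Point) : ℝ :=
  cosCoeff (fun t => P.nonlin (P.sol (p.withT t))) p.j

/-- The symbol of the linear operator on the non-resonant modes. -/
noncomputable def symb (p : Point) : ℝ :=
  P.om * (1 - (p.j : ℝ) ^ 2) + 2 + p.excess * (p.j : ℝ) ^ 2

/-- The source term in the non-resonant modes. -/
noncomputable def src (p : Point) : ℝ :=
  P.quad p.j * (P.amp p.next ^ 2 + P.amp p.prev ^ 2) - P.om * P.coefNonlin p -
    P.symb p * (P.quad p.j * P.amp p ^ 2)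

theorem src_eq {p : Point} (hp : p.Adm) : P.src p =
    P.quad p.j * (P.amp p.next ^ 2 + P.amp p.prev ^ 2 - 2 * P.amp p ^ 2) +
    -P.om * cosCoeff (fun t => P.nonlin (P.sol (p.withT t)) - P.lead (p.withT t)) p.j +
    (-4 * if p.j = 2 then P.α / 12 else 0) * (p.excess * P.amp p ^ 2) := by
  rw [cosCoeff_sub (P.continuous_nonlin_sol hp) (P.continuous_lead p), P.cosCoeff_lead, src,
    coefNonlin, symb, quad]
  by_cases h0 : p.j = 0
  · simp [h0]
    ring
  · by_cases h2 : p.j = 2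
    · simp [h2]
      ring
    · simp [h0, h2, Ne.symm h0, Ne.symm h2]

theorem est_src : Est P.src 1 9 10 := by
  have h1 := ((P.est_quad 10).mul P.est_lap_amp_sq).mono
    (by norm_num : 1 ≤ _) (by norm_num : 9 ≤ _) (by norm_num : 10 ≤ _)
  have h2 := (P.est_nonlin_sub_lead.cosCoeff fun p hp =>
    (P.continuous_nonlin_sol hp).sub (P.continuous_lead p)).const_mul (-P.om)
  have h3 : Est (fun p => -4 * if p.j = 2 then P.α / 12 else 0) 0 0 10 := by
    refine Est.of_indep 10 (fun _ _ => rfl) (abs_nonneg P.α) fun p _ => ?_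
    rw [pow_zero, pow_zero, mul_one, mul_one]
    split_ifs
    · rw [show -4 * (P.α / 12) = -(1 / 3) * P.α by ring, abs_mul]
      norm_num
      linarith [abs_nonneg P.α]
    · simp
  have h4 := (h3.mul ((est_excess 10).mul P.est_amp_sq)).mono
    (by norm_num : 1 ≤ _) (by norm_num : 9 ≤ _) (by norm_num : 10 ≤ _)
  exact ((h1.add h2).add h4).congr fun p hp => P.src_eq hp

/-- The source term of the equation for the amplitude correction. -/
noncomputable def newForce (p : Point) : ℝ :=
  P.om * P.coefNonlin (p.withJ 1) + (2 + p.excess) * P.amp p -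
    (P.bright p.next + P.bright p.prev) - linPot p.rate p.theta * p.corr

theorem est_newForce : Est P.newForce 1 11 11 := by
  have h1 := ((P.est_nonlin_sub_main.cosCoeff fun p hp =>
    (P.continuous_nonlin_sol hp).sub (P.continuous_main p)).comp_withJ 1).const_mul P.om
  have g2 := (est_prof 12).pow_two
  have r1 := est_recip 12
  have r2 := r1.pow_two
  have h2 := ((((est_prof 12).mul ((est_excess 12).mul r1)).sub
    ((g2.mul r1).const_mul 2 |>.mono le_rfl le_rfl (by norm_num))).mul (P.est_bright 12)).mono
    (by norm_num : 1 ≤ _) (by norm_num : 11 ≤ _) (by norm_num : 11 ≤ _)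
  have k1 := (g2.mul (((r1.const_mul (-12)).add (r2.const_mul 2 |>.mono le_rfl le_rfl
    (by norm_num))).add (((est_prof 12).mul r2).const_mul 6 |>.mono le_rfl (Nat.zero_le _)
    (by norm_num)))).mono (le_refl 0) (by norm_num : 12 ≤ _) (by norm_num : 12 ≤ _)
  have k2 := ((est_excess 12).mul ((((est_prof 12).const_mul 3).add (g2.mono le_rfl (by norm_num)
    (by norm_num))).mul r2)).mono (le_refl 0) (by norm_num : 12 ≤ _) (by norm_num : 12 ≤ _)
  have h3 := ((k1.add k2).mul est_corr).mono
    (by norm_num : 1 ≤ _) (by norm_num : 11 ≤ _) (by norm_num : 11 ≤ _)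
  have h4 := (((P.est_bright 11).mul est_corr.pow_two).const_mul (-3 * P.gam)).mono
    (by norm_num : 1 ≤ _) (by norm_num : 11 ≤ _) (by norm_num : 11 ≤ _)
  have h5 := ((est_corr.mul est_corr.pow_two).const_mul (-P.gam)).mono
    (by norm_num : 1 ≤ _) (by norm_num : 11 ≤ _) (by norm_num : 11 ≤ _)
  refine ((((h1.add h2).add h3).add h4).add h5).congr fun p hp => ?_
  have hm := P.cosCoeff_main p
  have hs := cosCoeff_sub (P.continuous_nonlin_sol hp) (P.continuous_main p) 1
  have hJ : P.coefNonlin (p.withJ 1) = cosCoeff (fun t => P.nonlin (P.sol (p.withT t))) 1 := rfl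
  have hG : P.gam = -(P.om * (P.β - 5 / 3 * P.α ^ 2)) / 8 := rfl
  have hB := P.gam_mul_bright_sq p
  have hr := p.recip_mul
  show _ = P.om * cosCoeff (fun t => P.nonlin (P.sol (p.withT t)) - P.main (p.withT t)) 1 +
    _ + _ + _ + _
  rw [hs, hm, newForce, P.bright_add, p.linPot_eq_recip, hJ]
  have hom : P.om * (P.β - 5 / 3 * P.α ^ 2) = -8 * P.gam := by rw [hG]; ring
  simp only [amp]
  generalize cosCoeff (fun t => P.nonlin (P.sol (p.withT t))) 1 = N
  generalize P.bright p = B at *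
  generalize p.corr = u
  generalize p.recip = r at *
  generalize p.prof = g at *
  generalize p.excess = e
  clear hm hs hJ hG
  linear_combination ((B + u) ^ 3 / 8) * hom - (B + 3 * u) * hB +
    (-e * B - 2 * B * (1 - g) + 6 * g * u * ((1 - g) * r + 1)) * hr
end Model
end KleinGordon

namespace KleinGordon

open Real Point
namespace Model
variable (P : Model)

/-- The margin in the non-resonance condition. -/
noncomputable def margin : ℝ := min (P.om - 4 / 3) (2 / 3)

theorem margin_pos : 0 < P.margin := lt_min (by linarith [P.om_gt]) (by norm_num)
theorem margin_le : P.margin ≤ 2 / 3 := min_le_right _ _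
theorem margin_le_om : P.margin ≤ P.om - 4 / 3 := min_le_left _ _

theorem le_abs_symb {p : Point} (he : p.excess ≤ P.margin / 4) (hj : p.j ≠ 1) :
    2 + 2 * P.margin ≤ |P.symb p| ∧ 2 / 5 * (1 + (p.j : ℝ) ^ 2) ≤ |P.symb p| := by
  have h0 := P.margin_pos
  have h1 := P.margin_le
  have h2 := P.margin_le_om
  unfold symb
  rcases Nat.eq_zero_or_pos p.j with h | h
  · rw [h]
    norm_num
    rw [abs_of_pos (by linarith)]
    constructor <;> linarith
  · have h3 : 2 ≤ p.j := by omega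
    have h4 : (4 : ℝ) ≤ (p.j : ℝ) ^ 2 := by
      have : (2 : ℝ) ≤ p.j := by exact_mod_cast h3
      nlinarith
    generalize (p.j : ℝ) ^ 2 = J at *
    have h5 : 0 ≤ (P.om - 4 / 3 - P.margin) * (J - 1) := mul_nonneg (by linarith) (by linarith)
    have h6 : 0 ≤ (P.margin / 4 - p.excess) * J := mul_nonneg (by linarith) (by linarith)
    have h7 : 0 ≤ P.margin * (J - 4) := mul_nonneg h0.le (by linarith)
    constructor <;> refine le_trans ?_ (neg_le_abs _) <;> nlinarith

/-- The updated remainder in the non-resonant modes. -/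
noncomputable def newRem (p : Point) : ℝ := (p.next.rem + p.prev.rem + P.src p) / P.symb p

/-- The updated unknown. -/
noncomputable def step (p : Point) : ℝ :=
  if p.j = 1 then P.newForce p / (p.lam ^ 10 * p.weight)
  else P.newRem p * (1 + (p.j : ℝ) ^ 2) / (p.lam ^ 8 * p.weight)

end Model

theorem abs_div_mul_div_le {μ a b s S N W D c : ℝ} (hμ : 0 < μ) (hN : 0 < N) (hW : 0 < W)
    (hD : 0 ≤ D) (hc : 0 ≤ c) (ha : |a| ≤ W * D / N) (hb : |b| ≤ (1 + μ) * (W * D / N))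
    (hs : |s| ≤ c * W * D) (hS : 2 + 2 * μ ≤ |S|) (hS' : 2 / 5 * N ≤ |S|) :
    |(a + b + s) / S * N / W| ≤ ((2 + μ) / (2 + 2 * μ) + 5 / 2 * c) * D := by
  have hS0 : 0 < |S| := by linarith
  rw [abs_div, abs_mul, abs_div, abs_of_pos hN, abs_of_pos hW, div_le_iff₀ hW, div_add' _ _ _ (by
    linarith), div_mul_eq_mul_div, div_mul_eq_mul_div, div_mul_eq_mul_div,
    div_le_div_iff₀ hS0 (by linarith)]
  have h1 : |a + b| * N ≤ (2 + μ) * (W * D) := by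
    have : |a + b| ≤ (2 + μ) * (W * D) / N := by
      refine (abs_add_le _ _).trans ((add_le_add ha hb).trans_eq ?_)
      ring
    rwa [le_div_iff₀ hN] at this
  have h2 : |s| * N ≤ 5 / 2 * c * (W * D) * |S| := by
    calc _ ≤ c * W * D * N := by gcongr
      _ = 5 / 2 * (c * W * D) * (2 / 5 * N) := by ring
      _ ≤ 5 / 2 * (c * W * D) * |S| := by gcongr
      _ = _ := by ring
  calc |a + b + s| * N * (2 + 2 * μ) ≤ (|a + b| + |s|) * N * (2 + 2 * μ) := by
        gcongr; exact abs_add_le _ _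
    _ = |a + b| * N * (2 + 2 * μ) + |s| * N * (2 + 2 * μ) := by ring
    _ ≤ (2 + μ) * (W * D) * |S| + 5 / 2 * c * (W * D) * |S| * (2 + 2 * μ) := by gcongr
    _ = _ := by ring

theorem abs_next_rem_le {p : Point} (hp : p.Adm) {x : ℕ × ℕ → ℝ} {d : ℝ}
    (hd : ∀ q, |p.x q - x q| ≤ d) : |p.next.rem - (p.withX x).next.rem| ≤
      p.lam ^ 8 * p.weight * d / (1 + (p.j : ℝ) ^ 2) := by
  have hd0 := (abs_nonneg _).trans (hd (0, 0))
  have h0 := hp.pos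
  refine (abs_rem_sub_le hp.next hd p.j).trans ?_
  show p.lam ^ 8 * p.next.weight * d / _ ≤ _
  gcongr
  exact hp.weight_next_le

theorem abs_prev_rem_le {p : Point} (hp : p.Adm) {μ : ℝ} (hμ : 0 < μ)
    (hy : 1 ≤ (1 + μ) * weightBase p.rate) {x : ℕ × ℕ → ℝ} {d : ℝ}
    (hd : ∀ q, |p.x q - x q| ≤ d) : |p.prev.rem - (p.withX x).prev.rem| ≤
      (1 + μ) * (p.lam ^ 8 * p.weight * d / (1 + (p.j : ℝ) ^ 2)) := by
  have hd0 := (abs_nonneg _).trans (hd (0, 0))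
  have h0 := hp.pos
  refine (abs_rem_sub_le hp.prev hd p.j).trans ?_
  show p.lam ^ 8 * p.prev.weight * d / _ ≤ _
  have h1 : p.prev.weight ≤ (1 + μ) * p.weight := by
    have := hp.weightBase_mul_weight_prev_le
    have := p.prev.weight_pos
    calc _ ≤ (1 + μ) * weightBase p.rate * p.prev.weight := le_mul_of_one_le_left this.le hy
      _ = (1 + μ) * (weightBase p.rate * p.prev.weight) := by ring
      _ ≤ _ := by gcongr
  calc _ ≤ p.lam ^ 8 * ((1 + μ) * p.weight) * d / (1 + (p.j : ℝ) ^ 2) := by gcongr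
    _ = _ := by ring

theorem rem_withX_zero (p : Point) : (p.withX 0).rem = 0 := by
  simp [rem, Point.withX]

namespace Model
variable (P : Model)

theorem exists_fixedPoint : ∃ l₀ > 0, ∀ (l : ℝ) (c : Bool), 0 < l → l ≤ l₀ →
    l ≤ 1 ∧ 2 * cosh (l ^ 3) - 2 ≤ P.margin / 4 ∧
    ∃ x : ℕ × ℕ → ℝ, (∀ q, |x q| ≤ 1) ∧ ∀ i j, P.step ⟨l, c, x, i, j, 0⟩ = x (i, j) := by
  obtain ⟨C₁, hC₁, h₁⟩ := P.est_src
  obtain ⟨C₂, hC₂, h₂⟩ := P.est_newForce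
  have hμ := P.margin_pos
  have hμ1 := P.margin_le
  set μ := P.margin with hμdef
  refine ⟨μ / (20 * (1 + C₁ + C₂)), by positivity, fun l c hl hl0 => ?_⟩
  rw [le_div_iff₀ (by positivity)] at hl0
  have hl1 : l ≤ μ / 20 := by nlinarith [mul_nonneg hC₁ hl.le, mul_nonneg hC₂ hl.le]
  have hl2 : C₁ * l ≤ μ / 20 := by nlinarith [mul_nonneg hC₁ hl.le, mul_nonneg hC₂ hl.le]
  have hl3 : C₂ * l ≤ μ / 20 := by nlinarith [mul_nonneg hC₁ hl.le, mul_nonneg hC₂ hl.le]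
  have hadm : ∀ x : ℕ × ℕ → ℝ, (∀ q, |x q| ≤ 1) → ∀ i j, (⟨l, c, x, i, j, 0⟩ : Point).Adm :=
    fun x hx i j => ⟨hl, by linarith, hx⟩
  have hexc : 2 * cosh (l ^ 3) - 2 ≤ μ / 4 := by
    have h := cosh_sub_one_le (pow_pos hl 3).le (pow_le_one₀ hl.le (by linarith))
    have h2 : (l ^ 3) ^ 2 ≤ l ^ 1 := by
      rw [← pow_mul]
      exact pow_le_pow_of_le_one hl.le (by linarith) (by norm_num)
    rw [pow_one] at h2
    linarith
  have hy : 1 ≤ (1 + μ) * weightBase (l ^ 3) := by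
    have h := add_one_le_exp (-(l ^ 3 / 2))
    have h2 : l ^ 3 ≤ l ^ 1 := pow_le_pow_of_le_one hl.le (by linarith) (by norm_num)
    rw [pow_one] at h2
    unfold weightBase
    nlinarith
  set q := (2 + μ) / (2 + 2 * μ) + 5 / 2 * (C₁ * l) with hq
  have hq0 : 1 / 2 ≤ q := by
    have : 1 / 2 ≤ (2 + μ) / (2 + 2 * μ) := by rw [le_div_iff₀ (by linarith)]; linarith
    have : 0 ≤ C₁ * l := by positivity
    linarith
  have hq1 : q < 1 := by
    have : (2 + μ) / (2 + 2 * μ) < 1 - μ / 8 := by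
      rw [div_lt_iff₀ (by linarith)]
      nlinarith
    linarith
  have hmap : ∀ x : ℕ × ℕ → ℝ, (∀ q, |x q| ≤ 1) → ∀ n : ℕ × ℕ,
      |P.step ⟨l, c, x, n.1, n.2, 0⟩| ≤ 1 := by
    intro x hx n
    have hp := hadm x hx n.1 n.2
    set p : Point := ⟨l, c, x, n.1, n.2, 0⟩
    have hw := p.weight_pos
    unfold step
    split_ifs with hj
    · rw [abs_div, abs_of_pos (mul_pos (pow_pos hp.pos 10) hw),
        div_le_iff₀ (mul_pos (pow_pos hp.pos 10) hw)]
      calc _ ≤ C₂ * l ^ 11 * p.weight ^ 1 := (h₂ p hp).1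
        _ = C₂ * l * (l ^ 10 * p.weight) := by ring
        _ ≤ 1 * (l ^ 10 * p.weight) := by gcongr; linarith
    · obtain ⟨hS, hS'⟩ := P.le_abs_symb (p := p) hexc hj
      have hd : ∀ q, |p.x q - (0 : ℕ × ℕ → ℝ) q| ≤ 1 := fun q => by
        rw [Pi.zero_apply, sub_zero]; exact hx q
      have ha := abs_next_rem_le hp hd
      have hb := abs_prev_rem_le hp hμ hy hd
      rw [show (p.withX 0).next.rem = 0 from rem_withX_zero p.next, sub_zero] at ha
      rw [show (p.withX 0).prev.rem = 0 from rem_withX_zero p.prev, sub_zero] at hb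
      refine (abs_div_mul_div_le hμ (by positivity) (mul_pos (pow_pos hp.pos 8) hw) zero_le_one
        (mul_nonneg hC₁ hl.le) ha hb ?_ hS hS').trans ?_
      · refine (h₁ p hp).1.trans_eq ?_
        show C₁ * l ^ 9 * _ = C₁ * l * (l ^ 8 * _) * 1
        ring
      · rw [mul_one]
        exact hq1.le
  have hlip : ∀ (x x' : ℕ × ℕ → ℝ) d, (∀ q, |x q| ≤ 1) → (∀ q, |x' q| ≤ 1) →
      (∀ q, |x q - x' q| ≤ d) → ∀ n : ℕ × ℕ,
      |P.step ⟨l, c, x, n.1, n.2, 0⟩ - P.step ⟨l, c, x', n.1, n.2, 0⟩| ≤ q * d := by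
    intro x x' d hx hx' hd n
    have hp := hadm x hx n.1 n.2
    have hd0 := (abs_nonneg _).trans (hd (0, 0))
    show |P.step ⟨l, c, x, n.1, n.2, 0⟩ - P.step (Point.withX ⟨l, c, x, n.1, n.2, 0⟩ x')| ≤ _
    set p : Point := ⟨l, c, x, n.1, n.2, 0⟩
    have hw := p.weight_pos
    by_cases hj : p.j = 1
    · have h3 : ∀ x, P.step (p.withX x) = P.newForce (p.withX x) / (p.lam ^ 10 * p.weight) :=
        fun x => if_pos hj
      rw [show P.step p = _ from h3 p.x, h3, ← sub_div, abs_div,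
        abs_of_pos (mul_pos (pow_pos hp.pos 10) hw), div_le_iff₀ (mul_pos (pow_pos hp.pos 10) hw)]
      calc _ ≤ C₂ * l ^ 11 * p.weight ^ 1 * d := (h₂ p hp).2 x' d hx' hd
        _ = C₂ * l * d * (l ^ 10 * p.weight) := by ring
        _ ≤ q * d * (l ^ 10 * p.weight) := by gcongr; linarith
    · obtain ⟨hS, hS'⟩ := P.le_abs_symb (p := p) hexc hj
      have h3 : ∀ x, P.step (p.withX x) = P.newRem (p.withX x) * (1 + (p.j : ℝ) ^ 2) /
        (p.lam ^ 8 * p.weight) := fun x => if_neg hj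
      have h4 : P.step p - P.step (p.withX x') = (p.next.rem - (p.withX x').next.rem +
          (p.prev.rem - (p.withX x').prev.rem) + (P.src p - P.src (p.withX x'))) / P.symb p *
          (1 + (p.j : ℝ) ^ 2) / (p.lam ^ 8 * p.weight) := by
        rw [show P.step p = _ from h3 p.x, h3]
        simp only [newRem]
        rw [show P.symb (p.withX x') = P.symb p from rfl,
          show P.symb (p.withX p.x) = P.symb p from rfl, show p.withX p.x = p from rfl]
        ring
      rw [h4]
      refine abs_div_mul_div_le hμ (by positivity) (mul_pos (pow_pos hp.pos 8) hw) hd0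
        (mul_nonneg hC₁ hl.le) (abs_next_rem_le hp hd) (abs_prev_rem_le hp hμ hy hd) ?_ hS hS'
      calc _ ≤ C₁ * l ^ 10 * p.weight ^ 1 * d := (h₁ p hp).2 x' d hx' hd
        _ ≤ C₁ * l ^ 9 * p.weight ^ 1 * d := by
          have := pow_le_pow_of_le_one hl.le (by linarith : l ≤ 1) (by norm_num : 9 ≤ 10)
          gcongr
        _ = C₁ * l * (l ^ 8 * p.weight) * d := by ring
  obtain ⟨x, hx, hfix⟩ := exists_fixedPoint_unitBall
    (fun (x : ℕ × ℕ → ℝ) (n : ℕ × ℕ) => P.step ⟨l, c, x, n.1, n.2, 0⟩) (q := q) (by linarith) hq1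
    hmap hlip
  exact ⟨by linarith, hexc, x, hx, fun i j => congrFun hfix (i, j)⟩

end Model
end KleinGordon

namespace KleinGordon

open Real Point
namespace Model
variable (P : Model)

theorem symb_mul_coef {l : ℝ} {c : Bool} {x : ℕ × ℕ → ℝ} (hl : 0 < l) (hl1 : l ≤ 1)
    (he : 2 * cosh (l ^ 3) - 2 ≤ P.margin / 4) (hx : ∀ q, |x q| ≤ 1)
    (hfix : ∀ i j, P.step ⟨l, c, x, i, j, 0⟩ = x (i, j)) (i j : ℕ) (t : ℝ) :
    P.symb ⟨l, c, x, i, j, t⟩ * P.coef ⟨l, c, x, i, j, t⟩ =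
      P.coef (next ⟨l, c, x, i, j, t⟩) + P.coef (prev ⟨l, c, x, i, j, t⟩) -
      P.om * P.coefNonlin ⟨l, c, x, i, j, t⟩ := by
  have hstep : P.step ⟨l, c, x, i, j, t⟩ = x (i, j) := hfix i j
  set p : Point := ⟨l, c, x, i, j, t⟩ with hpdef
  have hp : p.Adm := ⟨hl, hl1, hx⟩
  have hw := p.weight_pos
  have hN : 0 < 1 + (p.j : ℝ) ^ 2 := by positivity
  simp only [coef]
  rw [show p.next.j = p.j from rfl, show p.prev.j = p.j from rfl]
  by_cases hj : p.j = 1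
  · have hrem : ∀ q : Point, q.j = 1 → q.rem = 0 := fun q hq => if_pos hq
    rw [hrem p hj, hrem p.next hj, hrem p.prev hj]
    have hq : P.quad p.j = 0 := by simp [hj, quad]
    rw [hq, if_pos hj, if_pos hj, if_pos hj]
    have hs : P.symb p = 2 + p.excess := by rw [symb, hj]; push_cast; ring
    have hwj : p.withJ 1 = p := by rw [← hj]; rfl
    have h1 : P.newForce p = p.force := by
      rw [step, if_pos hj, div_eq_iff (mul_pos (pow_pos hl 10) hw).ne'] at hstep
      have hj' : j = 1 := hj
      rw [hstep, force, show p.x (p.i, 1) = x (i, j) by rw [hj']]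
      ring
    have h2 := corr_recurrence hp
    rw [newForce, hwj] at h1
    rw [hs]
    simp only [amp] at h1 ⊢
    linear_combination h1 - h2
  · obtain ⟨hS, -⟩ := P.le_abs_symb (p := p) he hj
    have hs : P.symb p ≠ 0 := fun h => by
      rw [h, abs_zero] at hS
      linarith [P.margin_pos]
    rw [if_neg hj, if_neg hj, if_neg hj]
    have h1 : P.newRem p = p.rem := by
      rw [step, if_neg hj, div_eq_iff (mul_pos (pow_pos hl 8) hw).ne'] at hstep
      rw [rem, if_neg hj, eq_div_iff hN.ne', hstep]
      show _ = p.lam ^ 8 * p.weight * x (i, j)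
      ring
    rw [newRem, div_eq_iff hs, src] at h1
    linear_combination -h1

theorem sol_withT_neg (p : Point) (t : ℝ) : P.sol (p.withT (-t)) = P.sol (p.withT t) :=
  cosSeries_neg (fun j => P.coef (p.withJ j)) t

theorem periodic_sol (p : Point) : Function.Periodic (fun t => P.sol (p.withT t)) (2 * π) :=
  periodic_cosSeries fun j => P.coef (p.withJ j)

theorem exists_deriv_sol {l : ℝ} {c : Bool} {x : ℕ × ℕ → ℝ} (hl : 0 < l) (hl1 : l ≤ 1)
    (he : 2 * cosh (l ^ 3) - 2 ≤ P.margin / 4) (hx : ∀ q, |x q| ≤ 1)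
    (hfix : ∀ i j, P.step ⟨l, c, x, i, j, 0⟩ = x (i, j)) (i : ℕ) :
    ∃ D H : ℝ → ℝ, (∀ t, HasDerivAt (fun t => P.sol ⟨l, c, x, i, 0, t⟩) (D t) t) ∧
      (∀ t, HasDerivAt D (H t) t) ∧ Continuous H ∧
      ∀ t, (P.om - (2 * cosh (l ^ 3) - 2)) * H t + P.om * (P.sol ⟨l, c, x, i, 0, t⟩ +
        P.nonlin (P.sol ⟨l, c, x, i, 0, t⟩)) = P.sol ⟨l, c, x, i + 1, 0, t⟩ +
        P.sol ⟨l, c, x, left c i, 0, t⟩ - 2 * P.sol ⟨l, c, x, i, 0, t⟩ := by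
  have hadm : ∀ n, Adm ⟨l, c, x, n, 0, 0⟩ := fun n => ⟨hl, hl1, hx⟩
  set z : ℕ → ℝ → ℝ := fun n t => P.sol ⟨l, c, x, n, 0, t⟩ with hz
  have hcont : ∀ n, Continuous (z n) := fun n => by
    have h := P.continuous_sol (hadm n)
    exact h
  have hnl : ∀ n, Continuous fun t => P.nonlin (z n t) := fun n =>
    P.continuous_nonlin.comp (hcont n)
  have heven : ∀ n t, z n (-t) = z n t := fun n => P.sol_withT_neg ⟨l, c, x, n, 0, 0⟩
  have hper : ∀ n, Function.Periodic (z n) (2 * π) := fun n => P.periodic_sol ⟨l, c, x, n, 0, 0⟩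
  have hcoef : ∀ n j, cosCoeff (z n) j = P.coef ⟨l, c, x, n, j, 0⟩ := fun n j => by
    obtain ⟨M, hM⟩ := P.exists_abs_coef_le (hadm n)
    exact cosCoeff_cosSeries hM j
  set e := 2 * cosh (l ^ 3) - 2 with hedef
  have hoe : P.om - e ≠ 0 := by linarith [P.om_gt, P.margin_le]
  set H : ℝ → ℝ := fun t => (P.om - e)⁻¹ * (z (i + 1) t + z (left c i) t -
    ((2 + P.om) * z i t + P.om * P.nonlin (z i t))) with hH
  have hc1 : Continuous fun t => z (i + 1) t + z (left c i) t := (hcont _).add (hcont _)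
  have hc2 : Continuous fun t => (2 + P.om) * z i t := continuous_const.mul (hcont i)
  have hc3 : Continuous fun t => P.om * P.nonlin (z i t) := continuous_const.mul (hnl i)
  have hc4 : Continuous fun t => (2 + P.om) * z i t + P.om * P.nonlin (z i t) := hc2.add hc3
  have hHc : Continuous H := continuous_const.mul (hc1.sub hc4)
  obtain ⟨M, hM⟩ := P.exists_abs_coef_le (hadm i)
  obtain ⟨D, hD, hD'⟩ := hasDerivAt_cosSeries (H := H) hM hHc
    (fun t => by simp only [hH, heven]) (fun t => by
      simp only [hH, (hper _) t]) (fun j => by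
      have h := P.symb_mul_coef hl hl1 he hx hfix i j 0
      rw [hH, cosCoeff_const_mul, cosCoeff_sub hc1 hc4, cosCoeff_add (hcont _) (hcont _),
        cosCoeff_add hc2 hc3, cosCoeff_const_mul, cosCoeff_const_mul, hcoef, hcoef,
        hcoef, inv_mul_eq_iff_eq_mul₀ hoe]
      have h1 : cosCoeff (fun t => P.nonlin (z i t)) j = P.coefNonlin ⟨l, c, x, i, j, 0⟩ := rfl
      have h2 : P.symb ⟨l, c, x, i, j, 0⟩ = P.om * (1 - (j : ℝ) ^ 2) + 2 + e * (j : ℝ) ^ 2 := rfl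
      rw [h1]
      rw [h2] at h
      change _ = P.coef ⟨l, c, x, i + 1, j, 0⟩ + P.coef ⟨l, c, x, left c i, j, 0⟩ - _ at h
      show _ = (P.om - e) * (-(j : ℝ) ^ 2 * P.coef ⟨l, c, x, i, j, 0⟩)
      linear_combination -h)
  refine ⟨D, H, hD, hD', hHc, fun t => ?_⟩
  rw [hH]
  field_simp
  ring

theorem le_bright {p : Point} (hp : p.Adm) (hi : p.i = 0) :
    √(2 / P.gam) * p.lam ^ 3 / 2 ≤ P.bright p := by
  have h1 : p.rate ≤ sinh p.rate := self_le_sinh_iff.mpr hp.rate_pos.le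
  have h2 : cosh p.theta ≤ 2 := by
    have h0 := hp.rate_pos
    have h1 := hp.rate_le_one
    refine cosh_le_two (phase_nonneg p.sym h0.le p.i) ?_
    rw [theta, hi, phase]
    split_ifs
    · norm_num
      linarith
    · norm_num
  have h3 : 1 / 2 ≤ 1 / cosh p.theta := one_div_le_one_div_of_le (cosh_pos _) h2
  have h4 := hp.rate_pos
  rw [bright]
  calc _ = √(2 / P.gam) * (p.rate * (1 / 2)) := by rw [rate]; ring
    _ ≤ _ := by gcongr

/-- Existence of small periodic solutions of the normalized lattice equation, folded by
reflection onto the half-line. -/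
theorem exists_half_line_breather : ∃ l₀ > 0, ∃ C ≥ 0, ∀ (l : ℝ) (c : Bool), 0 < l → l ≤ l₀ →
    l ≤ 1 ∧ ∃ z : ℕ → ℝ → ℝ, (∃ t, z 0 t ≠ 0) ∧ ∀ i,
      (∃ D H : ℝ → ℝ, (∀ t, HasDerivAt (z i) (D t) t) ∧
        (∀ t, HasDerivAt D (H t) t) ∧ Continuous H ∧
        ∀ t, (P.om - (2 * cosh (l ^ 3) - 2)) * H t + P.om * (z i t + P.nonlin (z i t)) =
          z (i + 1) t + z (left c i) t - 2 * z i t) ∧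
      (∀ t, z i (-t) = z i t) ∧ Function.Periodic (z i) (2 * π) ∧
      ∀ t, |z i t| ≤ C * l ^ 3 * weightBase (l ^ 3) ^ i := by
  obtain ⟨l₁, hl₁, h₁⟩ := P.exists_fixedPoint
  obtain ⟨C, hC, h₂⟩ := P.est_sol
  obtain ⟨C', hC', h₃⟩ := est_corr
  have hg := P.gam_pos
  set A := √(2 / P.gam) with hA
  have hA0 : 0 < A := sqrt_pos.mpr (by positivity)
  refine ⟨min l₁ (A / (4 * (C' + 1))), lt_min hl₁ (by positivity), C, hC, fun l c hl hl0 => ?_⟩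
  obtain ⟨hl1, he, x, hx, hfix⟩ := h₁ l c hl (hl0.trans (min_le_left _ _))
  have hl2 := hl0.trans (min_le_right _ _)
  rw [le_div_iff₀ (by positivity)] at hl2
  have hadm : ∀ i t, Adm ⟨l, c, x, i, 0, t⟩ := fun i t => ⟨hl, hl1, hx⟩
  refine ⟨hl1, fun i t => P.sol ⟨l, c, x, i, 0, t⟩, ?_, fun i =>
    ⟨P.exists_deriv_sol hl hl1 he hx hfix i, P.sol_withT_neg ⟨l, c, x, i, 0, 0⟩,
      P.periodic_sol ⟨l, c, x, i, 0, 0⟩, fun t =>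
      (h₂ _ (hadm i t)).1.trans_eq (by rw [pow_one]; rfl)⟩⟩
  by_contra! h
  set p : Point := ⟨l, c, x, 0, 0, 0⟩
  have hp : p.Adm := hadm 0 0
  obtain ⟨M, hM⟩ := P.exists_abs_coef_le hp
  have h4 : P.coef (p.withJ 1) = 0 := by
    rw [← cosCoeff_cosSeries hM 1,
      show cosSeries (fun j => P.coef (p.withJ j)) = fun _ => 0 from funext h]
    simp [cosCoeff]
  have h5 : P.amp p = 0 := by
    have : P.coef (p.withJ 1) = P.amp p := by
      simp [coef, Point.withJ, quad, rem]
      rfl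
    rw [← this, h4]
  have h6 := P.le_bright hp rfl
  have h7 := (h₃ p hp).1
  rw [amp] at h5
  have h8 := neg_le_of_abs_le h7
  have h9 : p.weight = 1 := pow_zero _
  rw [h9] at h8
  change A * l ^ 3 / 2 ≤ _ at h6
  change -(C' * l ^ 4 * 1 ^ 1) ≤ _ at h8
  nlinarith [pow_pos hl 3, pow_pos hl 4, mul_le_mul_of_nonneg_left hl2 (pow_pos hl 3).le]

end Model
end KleinGordon

namespace KleinGordon

open Real

/-- The reflection of the lattice onto the half-line: about the site `0`, or (for `c = true`) about
the midpoint between the sites `0` and `1`. -/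
def fold (c : Bool) (n : ℤ) : ℕ :=
  if c then if 1 ≤ n then (n - 1).toNat else (-n).toNat else n.natAbs

theorem fold_zero (c : Bool) : fold c 0 = 0 := by cases c <;> simp [fold]

theorem fold_true_neg_add_one (n : ℤ) : fold true (-n + 1) = fold true n := by
  simp only [fold, if_true]
  split_ifs <;> omega

theorem fold_false_neg (n : ℤ) : fold false (-n) = fold false n := by simp [fold]

theorem abs_le_fold_add_one (c : Bool) (n : ℤ) : |n| ≤ fold c n + 1 := by
  cases c
  · simp [fold]
  · simp only [fold, if_true]
    split_ifs
    · rw [abs_of_pos (by omega)]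
      omega
    · rw [abs_of_nonpos (by omega)]
      omega

theorem fold_neighbours (c : Bool) (n : ℤ) :
    fold c (n + 1) = fold c n + 1 ∧ fold c (n - 1) = left c (fold c n) ∨
    fold c (n - 1) = fold c n + 1 ∧ fold c (n + 1) = left c (fold c n) := by
  obtain ⟨i, hi⟩ : ∃ i, fold c n = i := ⟨_, rfl⟩
  rw [hi]
  cases c
  · cases i <;> simp only [fold, left, Bool.false_eq_true, if_false] at hi ⊢ <;> omega
  · cases i <;> simp only [fold, left, if_true] at hi ⊢ <;> split_ifs at * <;> omega

theorem add_fold_neighbours (c : Bool) (F : ℕ → ℝ) (n : ℤ) :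
    F (fold c (n + 1)) + F (fold c (n - 1)) = F (fold c n + 1) + F (left c (fold c n)) := by
  obtain ⟨h, h'⟩ | ⟨h, h'⟩ := fold_neighbours c n
  · rw [h, h']
  · rw [h, h', add_comm]

/-- Unfolding and rescaling a solution on the half-line to a solution on the lattice. -/
theorem lattice_of_half_line {V g : ℝ → ℝ} {m d a k ω e : ℝ} (ha : a ≠ 0) (hk : k ≠ 0)
    (hω : ω ≠ 0) (he : (a ^ 2 * d / k - e) * k = m * ω ^ 2) {c : Bool} {z : ℕ → ℝ → ℝ}
    (hV : ∀ i t, deriv V (z i t) = z i t + g (z i t))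
    (hz : ∀ i, ∃ D H : ℝ → ℝ, (∀ t, HasDerivAt (z i) (D t) t) ∧
        (∀ t, HasDerivAt D (H t) t) ∧ Continuous H ∧
        ∀ t, (a ^ 2 * d / k - e) * H t + a ^ 2 * d / k * (z i t + g (z i t)) =
          z (i + 1) t + z (left c i) t - 2 * z i t)
    (heven : ∀ i t, z i (-t) = z i t) (hper : ∀ i, Function.Periodic (z i) (2 * π))
    {x : ℤ → ℝ → ℝ} (hx : ∀ n t, x n t = z (fold c n) (ω * t) / a) :
    (∀ n : ℤ, ContDiff ℝ 2 (x n)) ∧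
    (∀ n : ℤ, ∀ t : ℝ, m * deriv (deriv (x n)) t + d * a * deriv V (a * x n t) =
      k * (x (n + 1) t - 2 * x n t + x (n - 1) t)) ∧
    (∀ n : ℤ, Function.Periodic (x n) (2 * π / ω)) ∧
    ∀ n : ℤ, ∀ t : ℝ, x n (-t) = x n t := by
  choose D H hD hH hHc heq using hz
  have hmul : ∀ t, HasDerivAt (fun t => ω * t) ω t := fun t => by
    simpa using (hasDerivAt_id t).const_mul ω
  have hd : ∀ n t, HasDerivAt (x n) (D (fold c n) (ω * t) * ω / a) t := fun n t => by
    rw [funext (hx n)]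
    exact ((hD _ _).comp t (hmul t)).div_const a
  have hd1 : ∀ n, deriv (x n) = fun t => D (fold c n) (ω * t) * ω / a :=
    fun n => funext fun t => (hd n t).deriv
  have hd' : ∀ n t, HasDerivAt (deriv (x n)) (H (fold c n) (ω * t) * ω * ω / a) t := fun n t => by
    rw [hd1]
    exact (((hH _ _).comp t (hmul t)).mul_const ω).div_const a
  have hd2 : ∀ n, deriv (deriv (x n)) = fun t => H (fold c n) (ω * t) * ω * ω / a :=
    fun n => funext fun t => (hd' n t).deriv
  refine ⟨fun n => ?_, fun n t => ?_, fun n t => ?_, fun n t => ?_⟩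
  · rw [show (2 : WithTop ℕ∞) = 1 + 1 from rfl, contDiff_succ_iff_deriv]
    refine ⟨fun t => (hd n t).differentiableAt, by simp, ?_⟩
    rw [contDiff_one_iff_deriv]
    refine ⟨fun t => (hd' n t).differentiableAt, ?_⟩
    rw [hd2]
    have := hHc (fold c n)
    fun_prop
  · have h1 := heq (fold c n) (ω * t)
    have h2 := add_fold_neighbours c (fun i => z i (ω * t)) n
    rw [hd2, hx, hx, hx, mul_div_cancel₀ _ ha, hV]
    simp only at h2 ⊢
    have h3 : a ^ 2 * d / k * k = a ^ 2 * d := div_mul_cancel₀ _ hk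
    field_simp
    linear_combination k * h1 - H (fold c n) (ω * t) * he - k * h2 -
      (z (fold c n) (ω * t) + g (z (fold c n) (ω * t))) * h3
  · rw [hx, hx, mul_add, mul_div_cancel₀ _ hω, hper]
  · rw [hx, hx, mul_neg, heven]

/-- The decay rate determined by the detuning from the band edge. -/
theorem exists_rate {e : ℝ} (he : 0 < e) (he1 : e ≤ 1) :
    ∃ κ, 0 < κ ∧ 2 * cosh κ - 2 = e ∧ √e / 2 ≤ κ ∧ κ ≤ √e := by
  have hs : 0 < √e := sqrt_pos.mpr he
  have hs1 : √e ≤ 1 := sqrt_le_one.mpr he1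
  have h0 : 0 < arsinh (√e / 2) := arsinh_pos_iff.mpr (by positivity)
  have h1 : sinh (arsinh (√e / 2)) = √e / 2 := sinh_arsinh _
  have h2 : arsinh (√e / 2) ≤ √e / 2 := by
    conv_rhs => rw [← h1]
    exact self_le_sinh_iff.mpr h0.le
  refine ⟨2 * arsinh (√e / 2), by positivity, ?_, ?_, by linarith⟩
  · rw [cosh_two_mul, cosh_sq, h1, div_pow, sq_sqrt he.le]
    ring
  · conv_lhs => rw [← h1]
    exact sinh_le_two_mul h0.le (by linarith)

theorem weightBase_pow_fold_le {κ : ℝ} (h0 : 0 < κ) (h1 : κ ≤ 1) (c : Bool) (n : ℤ) :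
    weightBase κ ^ fold c n ≤ 2 * exp (κ / 2) ^ (-|n|) := by
  have h2 : exp (κ / 2) ≤ 2 := by
    have := abs_le.mp (abs_exp_sub_one_le (x := κ / 2) (by rw [abs_of_pos] <;> linarith))
    rw [abs_of_pos (by linarith)] at this
    linarith
  have h3 : weightBase κ ^ fold c n = exp (κ / 2) ^ (-(fold c n : ℤ)) := by
    rw [weightBase, exp_neg, inv_pow, zpow_neg, zpow_natCast]
  have h4 := one_le_exp (by linarith : 0 ≤ κ / 2)
  calc _ ≤ exp (κ / 2) ^ (1 + -|n|) := by
        rw [h3]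
        exact zpow_le_zpow_right₀ h4 (by linarith [abs_le_fold_add_one c n])
    _ = exp (κ / 2) * exp (κ / 2) ^ (-|n|) := by rw [zpow_add₀ (exp_ne_zero _), zpow_one]
    _ ≤ _ := by gcongr

theorem exp_half_sub_one {κ : ℝ} (h0 : 0 < κ) (h1 : κ ≤ 1) :
    κ / 2 ≤ exp (κ / 2) - 1 ∧ exp (κ / 2) - 1 ≤ κ := by
  have h2 := abs_le.mp (abs_exp_sub_one_le (x := κ / 2) (by rw [abs_of_pos] <;> linarith))
  rw [abs_of_pos (by linarith)] at h2
  have h3 := add_one_le_exp (κ / 2)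
  constructor <;> linarith

/-- The comparison of the decay rate with the detuning of the frequency. -/
theorem detuning_bounds {m k w ω : ℝ} (hm : 0 < m) (hk : 0 < k) (hω : 0 < ω) (hw : ω < w) :
    √(m * w / k) * √(w - ω) ≤ √(m * (w ^ 2 - ω ^ 2) / k) ∧
    √(m * (w ^ 2 - ω ^ 2) / k) ≤ √(2 * (m * w / k)) * √(w - ω) := by
  have h1 : 0 < m * w / k := by have := hω.trans hw; positivity
  rw [← sqrt_mul h1.le, ← sqrt_mul (by positivity)]
  constructor <;> refine sqrt_le_sqrt ?_
  · rw [div_mul_eq_mul_div]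
    refine div_le_div_of_nonneg_right ?_ hk.le
    nlinarith [mul_pos hm (mul_pos (sub_pos.mpr hw) hω)]
  · rw [← mul_div_assoc, div_mul_eq_mul_div]
    refine div_le_div_of_nonneg_right ?_ hk.le
    nlinarith [mul_pos hm (mul_pos (sub_pos.mpr hw) (sub_pos.mpr hw))]

theorem exists_small_breather {V : ℝ → ℝ}
    (hV : ∃ r > (0 : ℝ), ContDiffOn ℝ 6 V (Metric.ball 0 r))
    (hV1 : deriv V 0 = 0) (hV2 : iteratedDeriv 2 V 0 = 1)
    {m d a k : ℝ} (ha : 0 < a) (hk : 0 < k)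
    (hh : iteratedDeriv 4 V 0 - 5 / 3 * (iteratedDeriv 3 V 0) ^ 2 < 0)
    (hΩ : 4 / 3 < a ^ 2 * d / k) :
    ∃ η > (0 : ℝ), ∃ C ≥ (0 : ℝ), ∀ (ω κ : ℝ) (c : Bool), 0 < ω → 0 < κ → κ ≤ η →
      (a ^ 2 * d / k - (2 * cosh κ - 2)) * k = m * ω ^ 2 →
      ∃ x : ℤ → ℝ → ℝ, (∃ n t, x n t ≠ 0) ∧
        ((∀ n : ℤ, ContDiff ℝ 2 (x n)) ∧
        (∀ n : ℤ, ∀ t : ℝ, m * deriv (deriv (x n)) t + d * a * deriv V (a * x n t) =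
          k * (x (n + 1) t - 2 * x n t + x (n - 1) t)) ∧
        (∀ n : ℤ, Function.Periodic (x n) (2 * π / ω)) ∧
        ∀ n : ℤ, ∀ t : ℝ, x n (-t) = x n t) ∧
        (∀ n n', fold c n = fold c n' → x n = x n') ∧
        ∀ (n : ℤ) (t : ℝ), |x n t| ≤ C * κ * exp (κ / 2) ^ (-|n|) := by
  obtain ⟨ρ, hρ, K, hK, T, hT0, hT, hVT⟩ := exists_cubic_expansion V hV hV1 hV2
  set P : Model := ⟨a ^ 2 * d / k, iteratedDeriv 3 V 0, iteratedDeriv 4 V 0, K, T, hΩ, hh, hK,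
    hT0, hT⟩ with hP
  obtain ⟨l₀, hl₀, C, hC, hmain⟩ := P.exists_half_line_breather
  refine ⟨min (min 1 (l₀ ^ 3)) (ρ / (C + 1)), by positivity, C * 2 / a, by positivity,
    fun ω κ c hω hκ hκη he => ?_⟩
  have hκ1 : κ ≤ 1 := hκη.trans ((min_le_left _ _).trans (min_le_left _ _))
  have hκl : κ ≤ l₀ ^ 3 := hκη.trans ((min_le_left _ _).trans (min_le_right _ _))
  have hκρ : C * κ ≤ ρ := by
    have := hκη.trans (min_le_right _ _)
    rw [le_div_iff₀ (by positivity)] at this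
    linarith
  obtain ⟨l, hl, rfl⟩ : ∃ l, 0 < l ∧ l ^ 3 = κ :=
    ⟨κ ^ (3⁻¹ : ℝ), by positivity, by
      rw [← rpow_natCast, ← rpow_mul hκ.le]
      norm_num⟩
  obtain ⟨-, z, ⟨t₀, ht₀⟩, hz⟩ := hmain l c hl (le_of_pow_le_pow_left₀ (by norm_num) hl₀.le hκl)
  have hzρ : ∀ i t, |z i t| ≤ ρ := fun i t => by
    refine ((hz i).2.2.2 t).trans (le_trans ?_ hκρ)
    refine mul_le_of_le_one_right (by positivity) ?_
    exact pow_le_one₀ (weightBase_pos _).le (weightBase_lt_one hκ).le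
  refine ⟨fun n t => z (fold c n) (ω * t) / a, ⟨0, t₀ / ω, ?_⟩,
    lattice_of_half_line (g := P.nonlin) ha.ne' hk.ne' hω.ne' he
    (fun i t => hVT _ (hzρ i t)) (fun i => (hz i).1) (fun i => (hz i).2.1)
    (fun i => (hz i).2.2.1) (fun _ _ => rfl), fun n n' h => by simp only [h], fun n t => ?_⟩
  · show z (fold c 0) (ω * (t₀ / ω)) / a ≠ 0
    rw [fold_zero, mul_div_cancel₀ _ hω.ne']
    exact div_ne_zero ht₀ ha.ne'
  · rw [abs_div, abs_of_pos ha, div_le_iff₀ ha]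
    calc _ ≤ C * l ^ 3 * weightBase (l ^ 3) ^ fold c n := (hz _).2.2.2 _
      _ ≤ C * l ^ 3 * (2 * exp (l ^ 3 / 2) ^ (-|n|)) := by
        gcongr
        exact weightBase_pow_fold_le hκ hκ1 c n
      _ = _ := by field_simp

end KleinGordon

open KleinGordon

/-- Existence of two families of small-amplitude discrete breathers with
frequencies just below the lower phonon band edge ω_min = √(a²d/m) for the
homogeneous Klein-Gordon lattice with soft potential (h < 0) under the
nonresonance condition Ω² = a²d/k > 4/3. -/
theorem stmt_16 (V : ℝ → ℝ) (hV : ∃ r > (0 : ℝ), ContDiffOn ℝ 6 V (Metric.ball 0 r))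
    (hV1 : deriv V 0 = 0) (hV2 : iteratedDeriv 2 V 0 = 1)
    (m d a k : ℝ) (hm : 0 < m) (hd : 0 < d) (ha : 0 < a) (hk : 0 < k)
    (hh : iteratedDeriv 4 V 0 - 5 / 3 * (iteratedDeriv 3 V 0) ^ 2 < 0)
    (hΩ : 4 / 3 < a ^ 2 * d / k) :
    let ωmin : ℝ := Real.sqrt (a ^ 2 * d / m)
    ∃ δ > (0 : ℝ), ∃ C ≥ (1 : ℝ), ∀ ω : ℝ, ωmin - δ < ω → ω < ωmin →
      ∃ x₁ x₂ : ℤ → ℝ → ℝ,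
        (∃ n t, x₁ n t ≠ 0) ∧ (∃ n t, x₂ n t ≠ 0) ∧
        (∀ x : ℤ → ℝ → ℝ, x = x₁ ∨ x = x₂ →
          (∀ n : ℤ, ContDiff ℝ 2 (x n)) ∧
          (∀ n : ℤ, ∀ t : ℝ,
            m * deriv (deriv (x n)) t + d * a * deriv V (a * x n t) =
              k * (x (n + 1) t - 2 * x n t + x (n - 1) t)) ∧
          (∀ n : ℤ, Function.Periodic (x n) (2 * Real.pi / ω)) ∧
          (∀ n : ℤ, ∀ t : ℝ, x n (-t) = x n t)) ∧
        (∀ n : ℤ, x₁ (-n + 1) = x₁ n) ∧ (∀ n : ℤ, x₂ (-n) = x₂ n) ∧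
        ∃ σ : ℝ, 1 < σ ∧
          (∀ x : ℤ → ℝ → ℝ, x = x₁ ∨ x = x₂ → ∀ n : ℤ, ∀ t : ℝ,
            |x n t| ≤ C * Real.sqrt (ωmin - ω) * σ ^ (-|n|)) ∧
          C⁻¹ * Real.sqrt (ωmin - ω) ≤ σ - 1 ∧
          σ - 1 ≤ C * Real.sqrt (ωmin - ω) := by
  intro w
  have hw : 0 < w := Real.sqrt_pos.mpr (by positivity)
  have hw2 : m * w ^ 2 = a ^ 2 * d := by
    rw [Real.sq_sqrt (by positivity)]
    field_simp
  obtain ⟨η, hη, A, hA, hmain⟩ := exists_small_breather (m := m) hV hV1 hV2 ha hk hh hΩ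
  set B := m * w / k with hB
  have hB0 : 0 < B := by positivity
  have hs0 : 0 < √B := Real.sqrt_pos.mpr hB0
  have hs1 := Real.sqrt_nonneg (2 * B)
  refine ⟨min w ((min 1 η) ^ 2 / (2 * B)), by positivity,
    1 + 4 / √B + √(2 * B) + A * √(2 * B), by
      have : 0 ≤ 4 / √B + √(2 * B) + A * √(2 * B) := by positivity
      linarith, fun ω hω1 hω2 => ?_⟩
  set C := 1 + 4 / √B + √(2 * B) + A * √(2 * B) with hC
  have hω : 0 < ω := by linarith [min_le_left w ((min 1 η) ^ 2 / (2 * B))]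
  have hu : 0 < w - ω := sub_pos.mpr hω2
  set e := m * (w ^ 2 - ω ^ 2) / k with he
  have he0 : 0 < e := div_pos (mul_pos hm (by nlinarith)) hk
  obtain ⟨hlow, hupp⟩ := detuning_bounds hm hk hω hω2
  rw [← he, ← hB] at hlow hupp
  have hsmall : √e ≤ min 1 η := by
    refine hupp.trans ?_
    rw [← Real.sqrt_mul (by positivity)]
    refine Real.sqrt_le_iff.mpr ⟨by positivity, ?_⟩
    have h : w - ω ≤ (min 1 η) ^ 2 / (2 * B) := by
      linarith [min_le_right w ((min 1 η) ^ 2 / (2 * B))]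
    rw [le_div_iff₀ (by positivity)] at h
    linarith
  obtain ⟨κ, hκ, hκe, hκ1, hκ2⟩ := exists_rate he0
    (Real.sqrt_le_one.mp (hsmall.trans (min_le_left _ _)))
  have hκle := hκ2.trans (hsmall.trans (min_le_left _ _))
  have hκη := hκ2.trans (hsmall.trans (min_le_right _ _))
  have hfreq : (a ^ 2 * d / k - (2 * Real.cosh κ - 2)) * k = m * ω ^ 2 := by
    rw [hκe, he, ← hw2]
    field_simp
    ring
  obtain ⟨x₁, hne₁, hsol₁, hsym₁, hb₁⟩ := hmain ω κ true hω hκ hκη hfreq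
  obtain ⟨x₂, hne₂, hsol₂, hsym₂, hb₂⟩ := hmain ω κ false hω hκ hκη hfreq
  have hκu : κ ≤ √(2 * B) * √(w - ω) := hκ2.trans hupp
  have hu0 := Real.sqrt_nonneg (w - ω)
  have h4 : 0 ≤ 4 / √B := by positivity
  have hAB : 0 ≤ A * √(2 * B) := by positivity
  have hC1 : √(2 * B) ≤ C := by linarith
  have hC2 : A * √(2 * B) ≤ C := by linarith
  have hC3 : 4 / √B ≤ C := by linarith
  have hbound : ∀ n : ℤ, A * κ * Real.exp (κ / 2) ^ (-|n|) ≤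
      C * √(w - ω) * Real.exp (κ / 2) ^ (-|n|) := fun n => by
    have : A * κ ≤ C * √(w - ω) := calc
      A * κ ≤ A * (√(2 * B) * √(w - ω)) := by gcongr
      _ = A * √(2 * B) * √(w - ω) := by ring
      _ ≤ _ := by gcongr
    gcongr
  obtain ⟨hexp1, hexp2⟩ := exp_half_sub_one hκ hκle
  refine ⟨x₁, x₂, hne₁, hne₂, ?_, fun n => hsym₁ _ _ (fold_true_neg_add_one n),
    fun n => hsym₂ _ _ (fold_false_neg n), Real.exp (κ / 2), by linarith, ?_, ?_, ?_⟩
  · rintro x (rfl | rfl)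
    exacts [hsol₁, hsol₂]
  · rintro x (rfl | rfl) n t
    exacts [(hb₁ n t).trans (hbound n), (hb₂ n t).trans (hbound n)]
  · rw [inv_mul_le_iff₀ (by linarith)]
    calc √(w - ω) = 4 / √B * (√B * √(w - ω) / 4) := by field_simp
      _ ≤ C * (Real.exp (κ / 2) - 1) := by
        gcongr
        linarith
  · refine hexp2.trans (hκu.trans ?_)
    gcongr
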